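/- arXiv:2406.16290 — 12 statements merged into one kernel-verified Lean document; each statement's English description precedes it below -/
import Mathlib

section
/- Let X and Y be nonempty sets and f : X × Y → ℝ a function. Suppose that f is t-convexlike on X for some t ∈ (0,1), that for every x ∈ X the function y ↦ f(x,y) is bounded on Y, and that sup_{y∈Y} inf_{x∈X} f(x,y) > −∞. Then f is infsup-convex on X. -/
open Filter Set

/-- A closed set of reals containing 0 and 1 and stable under `t`-mixing contains `[0,1]`. -/
lemma closed_mix_aux (A : Set ℝ) (hA : IsClosed A) (t : ℝ) (ht : t ∈ Set.Ioo (0 : ℝ) 1)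
    (h0 : (0 : ℝ) ∈ A) (h1 : (1 : ℝ) ∈ A)
    (hmix : ∀ a ∈ A, ∀ b ∈ A, t * a + (1 - t) * b ∈ A) (s : ℝ) (hs0 : 0 ≤ s) (hs1 : s ≤ 1) :
    s ∈ A := by
  obtain ⟨ht0, ht1⟩ := ht
  by_contra hs
  obtain ⟨a, ⟨haA, ha⟩, ha'⟩ := ((isCompact_Icc (a := (0:ℝ)) (b := s)).inter_left hA).exists_isGreatest
    ⟨0, h0, le_refl _, hs0⟩
  obtain ⟨b, ⟨hbA, hb⟩, hb'⟩ := ((isCompact_Icc (a := s) (b := (1:ℝ))).inter_left hA).exists_isLeast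
    ⟨1, h1, hs1, le_refl _⟩
  have has : a < s := lt_of_le_of_ne ha.2 (fun h => hs (h ▸ haA))
  have hbs : s < b := lt_of_le_of_ne hb.1 (fun h => hs (h ▸ hbA))
  have hm := hmix a haA b hbA
  have hlo : a < t * a + (1 - t) * b := by nlinarith
  have hhi : t * a + (1 - t) * b < b := by nlinarith
  rcases le_total (t * a + (1 - t) * b) s with h | h
  · exact absurd (ha' ⟨hm, ha.1.trans hlo.le, h⟩) (not_le.2 hlo)
  · exact absurd (hb' ⟨hm, h, hhi.le.trans hb.2⟩) (not_le.2 hhi)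

/-- The bounded functions which approximately dominate some `f x` form a convex set. -/
lemma convex_dom_aux {X Y : Type*} (f : X → Y → ℝ) (t : ℝ) (ht : t ∈ Set.Ioo (0 : ℝ) 1)
    (hconv : ∀ x₁ x₂ : X, ∃ x₃ : X, ∀ y : Y,
      f x₃ y ≤ t * f x₁ y + (1 - t) * f x₂ y) :
    Convex ℝ {g : Y → ℝ | (∃ C : ℝ, ∀ y, |g y| ≤ C) ∧
      ∀ ε : ℝ, 0 < ε → ∃ x, ∀ y, f x y ≤ g y + ε} := by
  rintro g₁ ⟨⟨C₁, hC₁⟩, hg₁⟩ g₂ ⟨⟨C₂, hC₂⟩, hg₂⟩ a b ha hb hab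
  obtain rfl : b = 1 - a := by linarith
  refine ⟨⟨a * C₁ + (1 - a) * C₂, fun y => ?_⟩, ?_⟩
  · have h1 := abs_le.1 (hC₁ y)
    have h2 := abs_le.1 (hC₂ y)
    simp only [Pi.add_apply, Pi.smul_apply, smul_eq_mul]
    rw [abs_le]
    constructor <;> nlinarith
  · simp only [Pi.add_apply, Pi.smul_apply, smul_eq_mul]
    refine closed_mix_aux {s : ℝ | ∀ ε : ℝ, 0 < ε → ∃ x, ∀ y,
      f x y ≤ s * g₁ y + (1 - s) * g₂ y + ε} ?_ t ht ?_ ?_ ?_ a ha (by linarith)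
    · refine isClosed_of_closure_subset fun s hs ε hε => ?_
      have hD : 0 < |C₁| + |C₂| + 1 := by positivity
      obtain ⟨r, hr, hsr⟩ := Metric.mem_closure_iff.1 hs (ε / 2 / (|C₁| + |C₂| + 1)) (by positivity)
      obtain ⟨x, hx⟩ := hr (ε / 2) (by positivity)
      refine ⟨x, fun y => (hx y).trans ?_⟩
      rw [Real.dist_eq, lt_div_iff₀ hD] at hsr
      have h3 : |g₁ y - g₂ y| ≤ |C₁| + |C₂| + 1 := by
        have := abs_sub (g₁ y) (g₂ y)
        linarith [hC₁ y, hC₂ y, le_abs_self C₁, le_abs_self C₂]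
      have h4 : |(s - r) * (g₁ y - g₂ y)| ≤ ε / 2 := by
        rw [abs_mul]
        exact (mul_le_mul_of_nonneg_left h3 (abs_nonneg _)).trans hsr.le
      have := (abs_le.1 h4).1
      linarith
    · simpa using hg₂
    · simpa using hg₁
    · intro p hp q hq ε hε
      obtain ⟨x₁, h₁⟩ := hp ε hε
      obtain ⟨x₂, h₂⟩ := hq ε hε
      obtain ⟨x₃, h₃⟩ := hconv x₁ x₂
      refine ⟨x₃, fun y => (h₃ y).trans ?_⟩
      have e1 := mul_le_mul_of_nonneg_left (h₁ y) ht.1.le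
      have e2 := mul_le_mul_of_nonneg_left (h₂ y) (sub_nonneg.2 ht.2.le)
      linarith

/-- If `f : X × Y → ℝ` is `t`-convexlike on `X` for some `t ∈ (0,1)`,
`f(x,·)` is bounded on `Y` for every `x`, and `sup_y inf_x f(x,y) > -∞`, then `f` is
infsup-convex on `X`. -/
theorem proposition_infsup_convex {X Y : Type*} [Nonempty X] [Nonempty Y]
    (f : X → Y → ℝ) (t : ℝ) (ht : t ∈ Set.Ioo (0 : ℝ) 1)
    (hconv : ∀ x₁ x₂ : X, ∃ x₃ : X, ∀ y : Y,
      f x₃ y ≤ t * f x₁ y + (1 - t) * f x₂ y)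
    (hbdd : ∀ x : X, ∃ C : ℝ, ∀ y : Y, |f x y| ≤ C)
    (hfin : ⊥ < ⨆ y : Y, ⨅ x : X, (f x y : EReal)) :
    (⨅ x : X, ⨆ y : Y, (f x y : EReal)) =
      ⨅ (n : ℕ) (_ : 0 < n) (xs : Fin n → X) (lam : Fin n → ℝ)
        (_ : lam ∈ stdSimplex ℝ (Fin n)),
        ⨆ y : Y, ((∑ i, lam i * f (xs i) y : ℝ) : EReal) := by
  apply le_antisymm
  · refine le_iInf fun n => le_iInf fun _ => le_iInf fun xs => le_iInf fun lam => le_iInf fun hl => ?_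
    have hmem := (convex_dom_aux f t ht hconv).sum_mem (t := Finset.univ) (w := lam)
      (z := fun i => f (xs i)) (fun i _ => hl.1 i) hl.2
      (fun i _ => ⟨hbdd (xs i), fun ε hε => ⟨xs i, fun y => by linarith⟩⟩)
    have hdom := hmem.2
    simp only [Finset.sum_apply, Pi.smul_apply, smul_eq_mul] at hdom
    refine EReal.le_of_forall_lt_iff_le.1 fun z hz => ?_
    obtain ⟨w, hw1, hw2⟩ := EReal.lt_iff_exists_real_btwn.1 hz
    have hwz : w < z := EReal.coe_lt_coe_iff.1 hw2
    obtain ⟨x, hx⟩ := hdom (z - w) (by linarith)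
    refine (iInf_le _ x).trans (iSup_le fun y => ?_)
    have hy : ∑ i, lam i * f (xs i) y ≤ w :=
      EReal.coe_le_coe_iff.1 ((le_iSup (fun y => ((∑ i, lam i * f (xs i) y : ℝ) : EReal)) y).trans hw1.le)
    exact EReal.coe_le_coe_iff.2 (by linarith [hx y])
  · refine le_iInf fun x => ?_
    refine iInf_le_of_le 1 (iInf_le_of_le one_pos (iInf_le_of_le (fun _ => x)
      (iInf_le_of_le (fun _ => 1) (iInf_le_of_le ⟨fun _ => zero_le_one, by simp⟩ ?_))))
    simp
end

section
/- Let X and Y be nonempty sets and f : X × Y → ℝ a function. Suppose that f is s-concavelike on Y for some s ∈ (0,1), that for every y ∈ Y the function x ↦ f(x,y) is bounded on X, and that inf_{x∈X} sup_{y∈Y} f(x,y) < +∞. Then f is supinf-concave on Y. -/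
open Filter Set

/-- A closed subset of the unit interval containing the end points and stable under
`(a, b) ↦ s a + (1 - s) b` is everything. -/
lemma aux_closed_mix (s : ℝ) (hs : s ∈ Set.Ioo (0 : ℝ) 1) (T : Set ℝ) (hT : IsClosed T)
    (h0 : (0 : ℝ) ∈ T) (h1 : (1 : ℝ) ∈ T)
    (hmix : ∀ a ∈ T, ∀ b ∈ T, s * a + (1 - s) * b ∈ T)
    (t : ℝ) (ht0 : 0 ≤ t) (ht1 : t ≤ 1) : t ∈ T := by
  obtain ⟨hs0, hs1⟩ := hs
  by_contra hn
  have bA : BddAbove (T ∩ Iic t) := ⟨t, fun _ h => h.2⟩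
  have bB : BddBelow (T ∩ Ici t) := ⟨t, fun _ h => h.2⟩
  have hA := (hT.inter isClosed_Iic).csSup_mem ⟨0, h0, ht0⟩ bA
  have hB := (hT.inter isClosed_Ici).csInf_mem ⟨1, h1, ht1⟩ bB
  set a := sSup (T ∩ Iic t) with ha
  set b := sInf (T ∩ Ici t) with hb
  have hat : a < t := lt_of_le_of_ne hA.2 (fun h => hn (h ▸ hA.1))
  have htb : t < b := lt_of_le_of_ne hB.2 (fun h => hn (h ▸ hB.1))
  have hab : 0 < b - a := by linarith
  have hc := hmix a hA.1 b hB.1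
  rcases le_total (s * a + (1 - s) * b) t with h | h
  · have := le_csSup bA ⟨hc, h⟩
    nlinarith [mul_pos (sub_pos.2 hs1) hab]
  · have := csInf_le bB ⟨hc, h⟩
    nlinarith [mul_pos hs0 hab]

/-- Bounded functions which are dominated, up to any `ε`, by some `f · y`, form a convex set. -/
lemma aux_convex {X Y : Type*} (f : X → Y → ℝ) (s : ℝ) (hs : s ∈ Set.Ioo (0 : ℝ) 1)
    (hconc : ∀ y₁ y₂ : Y, ∃ y₃ : Y, ∀ x : X,
      s * f x y₁ + (1 - s) * f x y₂ ≤ f x y₃) :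
    Convex ℝ {g : X → ℝ | (∃ C : ℝ, ∀ x, |g x| ≤ C) ∧
      ∀ ε > 0, ∃ y, ∀ x, g x - ε ≤ f x y} := by
  rintro g ⟨⟨C, hC⟩, hg⟩ h ⟨⟨D, hD⟩, hh⟩ p q hp hq hpq
  obtain rfl : q = 1 - p := by linarith
  refine ⟨⟨p * C + (1 - p) * D, fun x => ?_⟩, ?_⟩
  · simp only [Pi.add_apply, Pi.smul_apply, smul_eq_mul]
    refine (abs_add_le _ _).trans ?_
    rw [abs_mul, abs_mul, abs_of_nonneg hp, abs_of_nonneg hq]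
    have := hC x
    have := hD x
    gcongr
  · have key := aux_closed_mix s hs
      {t : ℝ | ∀ ε > 0, ∃ y, ∀ x, t * g x + (1 - t) * h x - ε ≤ f x y} ?_ ?_ ?_ ?_ p hp
      (by linarith)
    · simpa using key
    · rw [← closure_subset_iff_isClosed]
      intro t ht ε hε
      rw [Metric.mem_closure_iff] at ht
      set K := |C| + |D| + 1 with hK
      have hKpos : 0 < K := by positivity
      obtain ⟨t', ht', hd⟩ := ht (ε / 2 / K) (by positivity)
      obtain ⟨y, hy⟩ := ht' (ε / 2) (by positivity)
      refine ⟨y, fun x => ?_⟩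
      have h1 := hy x
      have h2 : |g x - h x| ≤ K := by
        have := abs_sub (g x) (h x)
        linarith [hC x, hD x, le_abs_self C, le_abs_self D]
      have h3 : |(t - t') * (g x - h x)| ≤ ε / 2 := by
        rw [abs_mul]
        rw [Real.dist_eq] at hd
        calc |t - t'| * |g x - h x| ≤ (ε / 2 / K) * K := by gcongr
          _ = ε / 2 := by field_simp
      have h4 := (abs_le.1 h3).2
      linarith
    · simpa using hh
    · simpa using hg
    · intro a ha b hb ε hε
      obtain ⟨y₁, h1⟩ := ha ε hε
      obtain ⟨y₂, h2⟩ := hb ε hε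
      obtain ⟨y₃, h3⟩ := hconc y₁ y₂
      refine ⟨y₃, fun x => ?_⟩
      have e1 := mul_le_mul_of_nonneg_left (h1 x) hs.1.le
      have e2 := mul_le_mul_of_nonneg_left (h2 x) (sub_nonneg.2 hs.2.le)
      have e3 := h3 x
      linarith

/-- If `f : X × Y → ℝ` is `s`-concavelike on `Y` for some `s ∈ (0,1)`,
`f(·,y)` is bounded on `X` for every `y`, and `inf_x sup_y f(x,y) < +∞`, then `f` is
supinf-concave on `Y`. -/
theorem proposition_supinf_concave {X Y : Type*} [Nonempty X] [Nonempty Y]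
    (f : X → Y → ℝ) (s : ℝ) (hs : s ∈ Set.Ioo (0 : ℝ) 1)
    (hconc : ∀ y₁ y₂ : Y, ∃ y₃ : Y, ∀ x : X,
      s * f x y₁ + (1 - s) * f x y₂ ≤ f x y₃)
    (hbdd : ∀ y : Y, ∃ C : ℝ, ∀ x : X, |f x y| ≤ C)
    (hfin : (⨅ x : X, ⨆ y : Y, (f x y : EReal)) < ⊤) :
    (⨆ y : Y, ⨅ x : X, (f x y : EReal)) =
      ⨆ (n : ℕ) (_ : 0 < n) (ys : Fin n → Y) (lam : Fin n → ℝ)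
        (_ : lam ∈ stdSimplex ℝ (Fin n)),
        ⨅ x : X, ((∑ i, lam i * f x (ys i) : ℝ) : EReal) := by
  apply le_antisymm
  · refine iSup_le fun y => ?_
    refine le_iSup_of_le 1 <| le_iSup_of_le one_pos <| le_iSup_of_le (fun _ => y) <|
      le_iSup_of_le (fun _ => 1) <| le_iSup_of_le ⟨fun _ => zero_le_one, by simp⟩ ?_
    simp
  · refine iSup_le fun n => iSup_le fun _ => iSup_le fun ys => iSup_le fun lam =>
      iSup_le fun hlam => ?_
    have hmem := (aux_convex f s hs hconc).sum_mem (t := Finset.univ) (w := lam)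
      (z := fun i x => f x (ys i)) (fun i _ => hlam.1 i) hlam.2
      (fun i _ => ⟨hbdd (ys i), fun ε hε => ⟨ys i, fun x => by linarith⟩⟩)
    have hP := hmem.2
    simp only [Finset.sum_apply, Pi.smul_apply, smul_eq_mul] at hP
    refine EReal.ge_of_forall_gt_iff_ge.1 fun r hr => ?_
    obtain ⟨r', h1, h2⟩ := EReal.lt_iff_exists_real_btwn.1 hr
    have h1' : r < r' := by exact_mod_cast h1
    obtain ⟨y, hy⟩ := hP (r' - r) (by linarith)
    refine le_iSup_of_le y (le_iInf fun x => ?_)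
    have h3 := h2.le.trans (iInf_le _ x)
    have h3' : r' ≤ ∑ i, lam i * f x (ys i) := by exact_mod_cast h3
    have h4 : r ≤ f x y := by linarith [hy x]
    exact_mod_cast h4
end

section
/- Let X be a topological space and A a nonempty convex subset of C_b(X). Then exactly one of the following two alternatives holds: (A1) there exists Φ₀ ∈ A with sup_{x∈X} Φ₀(x) < 0; (A2) there exists ν ∈ conv̄^{w*}{δ_x : x ∈ X} such that ⟨ν, Φ⟩ ≥ 0 for all Φ ∈ A. -/
open Filter Set BoundedContinuousFunction

/-- The Dirac evaluation functional `δ_x` on `C_b(X)`, as an element of the weak-* dual. -/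
noncomputable def diracCb (X : Type*) [TopologicalSpace X] (x : X) :
    WeakDual ℝ (X →ᵇ ℝ) :=
  BoundedContinuousFunction.evalCLM ℝ x

/-- Separation of a point from a weak-* closed convex set by an evaluation. -/
lemma weakDual_separation {E : Type*} [NormedAddCommGroup E] [NormedSpace ℝ E]
    (S : Set (WeakDual ℝ E)) (hS : Convex ℝ S) (hSc : IsClosed S) (ν : WeakDual ℝ E)
    (hν : ν ∉ S) : ∃ (g : E) (s : ℝ), (∀ μ ∈ S, μ g < s) ∧ s < ν g := by
  have : LocallyConvexSpace ℝ (WeakDual ℝ E) :=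
    (WeakDual.withSeminorms ℝ E).toLocallyConvexSpace
  obtain ⟨F, s, hF, hs⟩ := geometric_hahn_banach_closed_point hS hSc hν
  obtain ⟨g, hg⟩ := LinearMap.dualEmbedding_surjective (topDualPairing ℝ E) F
  have hFe : ∀ μ : WeakDual ℝ E, F μ = μ g := by
    intro μ
    exact (DFunLike.congr_fun hg μ).symm
  refine ⟨g, s, fun μ hμ => ?_, ?_⟩
  · rw [← hFe]
    exact hF μ hμ
  · rw [← hFe]
    exact hs

/-- A positive normalized functional lies in the weak-* closed convex hull of Diracs. -/
lemma mem_hull_of_pos {X : Type*} [TopologicalSpace X] (ν : WeakDual ℝ (X →ᵇ ℝ))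
    (hpos : ∀ g : X →ᵇ ℝ, (∀ x, 0 ≤ g x) → 0 ≤ ν g) (h1 : ν 1 = 1) :
    ν ∈ closure (convexHull ℝ (Set.range (diracCb X))) := by
  by_contra hν
  obtain ⟨g, s, hF, hs⟩ := weakDual_separation _
    (convex_convexHull ℝ (Set.range (diracCb X))).closure isClosed_closure ν hν
  have hx : ∀ x, g x < s := by
    intro x
    exact hF _ (subset_closure (subset_convexHull ℝ _ ⟨x, rfl⟩))
  have h2 := hpos (s • (1 : X →ᵇ ℝ) - g) (by
    intro x
    have := hx x
    simp
    linarith)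
  rw [map_sub, map_smul, h1] at h2
  simp at h2
  linarith

/-- **alternative theorem.** For a nonempty convex subset `A` of `C_b(X)`,
exactly one of the following holds: (A1) some `Φ₀ ∈ A` satisfies `sup_X Φ₀ < 0`;
(A2) some `ν` in the weak-* closed convex hull of the Dirac functionals satisfies
`⟨ν, Φ⟩ ≥ 0` for all `Φ ∈ A`. -/
theorem alternative_theorem {X : Type*} [TopologicalSpace X]
    (A : Set (X →ᵇ ℝ)) (hA : A.Nonempty) (hAconv : Convex ℝ A) :
    Xor'
      (∃ Φ₀ ∈ A, (⨆ x : X, (Φ₀ x : EReal)) < 0)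
      (∃ ν ∈ closure (convexHull ℝ (Set.range (diracCb X))),
        ∀ Φ ∈ A, 0 ≤ ν Φ) := by
  have excl : ¬ ((∃ Φ₀ ∈ A, (⨆ x : X, (Φ₀ x : EReal)) < 0) ∧
      (∃ ν ∈ closure (convexHull ℝ (Set.range (diracCb X))), ∀ Φ ∈ A, 0 ≤ ν Φ)) := by
    rintro ⟨⟨Φ, hΦ, hsup⟩, ν, hν, hνA⟩
    obtain ⟨c, hc1, hc2⟩ := EReal.lt_iff_exists_real_btwn.1 hsup
    have hc : c < 0 := by exact_mod_cast hc2
    have hx : ∀ x, Φ x ≤ c := by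
      intro x
      have := (le_iSup (fun x : X => (Φ x : EReal)) x).trans hc1.le
      exact_mod_cast this
    have hsub : closure (convexHull ℝ (Set.range (diracCb X))) ⊆
        {μ : WeakDual ℝ (X →ᵇ ℝ) | μ Φ ≤ c} := by
      apply closure_minimal
      · apply convexHull_min
        · rintro _ ⟨x, rfl⟩
          exact hx x
        · intro μ hμ η hη a b ha hb hab
          have e : (a • μ + b • η) Φ = a * μ Φ + b * η Φ := rfl
          simp only [mem_setOf_eq] at *
          rw [e]
          calc a * μ Φ + b * η Φ ≤ a * c + b * c := by gcongr
            _ = c := by rw [← add_mul, hab, one_mul]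
      · exact isClosed_le (WeakDual.eval_continuous Φ) continuous_const
    have := hsub hν
    have h2 := hνA Φ hΦ
    simp only [mem_setOf_eq] at this
    linarith
  have ex : ¬ (∃ Φ₀ ∈ A, (⨆ x : X, (Φ₀ x : EReal)) < 0) →
      (∃ ν ∈ closure (convexHull ℝ (Set.range (diracCb X))), ∀ Φ ∈ A, 0 ≤ ν Φ) := by
    intro hn
    let N : Set (X →ᵇ ℝ) := {f | ∃ ε > 0, ∀ x, f x ≤ -ε}
    have hNc : Convex ℝ N := by
      rintro f ⟨ε, hε, hf⟩ g ⟨δ, hδ, hg⟩ a b ha hb hab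
      refine ⟨min ε δ, lt_min hε hδ, fun x => ?_⟩
      have h1 := (hf x).trans (neg_le_neg (min_le_left ε δ))
      have h2 := (hg x).trans (neg_le_neg (min_le_right ε δ))
      change a * f x + b * g x ≤ _
      calc a * f x + b * g x ≤ a * (-min ε δ) + b * (-min ε δ) := by gcongr
        _ = _ := by rw [← add_mul, hab, one_mul]
    have hNo : IsOpen N := by
      rw [Metric.isOpen_iff]
      rintro f ⟨ε, hε, hf⟩
      refine ⟨ε / 2, half_pos hε, fun g hg => ⟨ε / 2, half_pos hε, fun x => ?_⟩⟩
      have h1 := (BoundedContinuousFunction.dist_coe_le_dist (f := g) (g := f) x).trans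
        (Metric.mem_ball.1 hg).le
      rw [Real.dist_eq] at h1
      have := (abs_le.1 h1).2
      have := hf x
      linarith
    have hdisj : Disjoint N A := by
      rw [Set.disjoint_left]
      rintro f ⟨ε, hε, hf⟩ hfA
      refine hn ⟨f, hfA, lt_of_le_of_lt (b := ((-ε : ℝ) : EReal)) (iSup_le fun x => ?_) ?_⟩
      · exact_mod_cast hf x
      · have : -ε < 0 := by linarith
        exact_mod_cast this
    obtain ⟨f, u, hfN, hfA⟩ := geometric_hahn_banach_open hNc hNo hAconv hdisj
    have key : ∀ g : X →ᵇ ℝ, (∀ x, 0 ≤ g x) → ∀ t ≥ 0, ∀ r > 0, -t * f g - r * f 1 < u := by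
      intro g hg t ht r hr
      have := hfN ((-t) • g - r • (1 : X →ᵇ ℝ)) ⟨r, hr, fun x => by
        have := mul_nonneg ht (hg x)
        simp
        linarith⟩
      simpa using this
    have hpos : ∀ g : X →ᵇ ℝ, (∀ x, 0 ≤ g x) → 0 ≤ f g := by
      intro g hg
      by_contra! hlt
      have := key g hg ((|u| + |f 1|) / (-f g)) (by
        apply div_nonneg <;> [positivity; linarith]) 1 one_pos
      have e : -((|u| + |f 1|) / (-f g)) * f g = |u| + |f 1| := by
        have : f g ≠ 0 := hlt.ne
        field_simp
      rw [e] at this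
      have := le_abs_self u
      have := le_abs_self (f 1)
      linarith
    have h1 : 0 ≤ f 1 := hpos 1 fun x => by simp
    have hu : 0 ≤ u := by
      by_contra! hlt
      have := key 0 (fun x => le_rfl) 0 le_rfl (-u / (f 1 + 1)) (by
        apply div_pos <;> linarith)
      simp only [map_zero, mul_zero, zero_sub] at this
      rw [← neg_mul, ← neg_div, neg_neg, div_mul_eq_mul_div, div_lt_iff₀ (by linarith)] at this
      nlinarith
    have h1' : 0 < f 1 := by
      rcases h1.lt_or_eq with h | h
      · exact h
      · exfalso
        obtain ⟨Φ, hΦ⟩ := hA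
        have a1 := key 0 (fun x => le_rfl) 0 le_rfl 1 one_pos
        have a2 := hfA Φ hΦ
        have a3 := hpos (‖Φ‖ • (1 : X →ᵇ ℝ) - Φ) (fun x => by
          have := (le_abs_self _).trans (Φ.norm_coe_le_norm x)
          simp
          linarith)
        rw [map_sub, map_smul, ← h] at a3
        simp [← h] at a1 a3
        linarith
    let ν : WeakDual ℝ (X →ᵇ ℝ) := ((f 1)⁻¹ • f : StrongDual ℝ (X →ᵇ ℝ))
    have hνe : ∀ g, ν g = (f 1)⁻¹ * f g := fun g => rfl
    refine ⟨ν, mem_hull_of_pos ν (fun g hg => ?_) ?_, fun Φ hΦ => ?_⟩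
    · rw [hνe]
      exact mul_nonneg (inv_nonneg.2 h1) (hpos g hg)
    · rw [hνe]
      exact inv_mul_cancel₀ h1'.ne'
    · rw [hνe]
      exact mul_nonneg (inv_nonneg.2 h1) (hu.trans (hfA Φ hΦ))
  by_cases h : ∃ Φ₀ ∈ A, (⨆ x : X, (Φ₀ x : EReal)) < 0
  · exact Or.inl ⟨h, fun h2 => excl ⟨h, h2⟩⟩
  · exact Or.inr ⟨ex h, h⟩
end

section
/- Let X and Y be nonempty sets and φ : X × X → ℝ, f : X × Y → ℝ two functions satisfying: (a1) every net (x_α)_{α∈I} in X admits a subnet (x_{h(α)}) such that inf_{x∈X} limsup_α φ(x, x_{h(α)}) ≤ 0; (a2) there exists t ∈ (0,1) such that for every x₁, x₂ ∈ X there exists x₃ ∈ X with t·φ(x₃,x₁) + (1−t)·φ(x₃,x₂) ≤ 0; (a3) there exists K ≥ 0 such that f(x₁,y) − f(x₂,y) ≤ K·φ(x₁,x₂) for all x₁, x₂ ∈ X and all y ∈ Y. Then f is t-convexlike on X and f satisfies the Simons-like inequality. -/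
open Filter Set

/-- A net in `X`: a function from a nonempty directed preorder into `X`. -/
structure NetIn (X : Type*) where
  ι : Type
  [pre : Preorder ι]
  [dir : IsDirected ι (· ≤ ·)]
  [non : Nonempty ι]
  x : ι → X

attribute [instance] NetIn.pre NetIn.dir NetIn.non

/-- **Example.** Suppose `φ : X × X → ℝ` and `f : X × Y → ℝ` satisfy:
(a1) every net in `X` has a subnet `(x_{h(α)})` with `inf_x limsup_α φ(x, x_{h(α)}) ≤ 0`;
(a2) for some `t ∈ (0,1)`, for all `x₁, x₂` there is `x₃` with
`t φ(x₃,x₁) + (1-t) φ(x₃,x₂) ≤ 0`; (a3) for some `K ≥ 0`,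
`f(x₁,y) − f(x₂,y) ≤ K φ(x₁,x₂)` for all `x₁, x₂, y`.
Then `f` is `t`-convexlike on `X` and satisfies the Simons-like inequality. -/
theorem example_simons_like {X Y : Type*} [Nonempty X] [Nonempty Y]
    (φ : X → X → ℝ) (f : X → Y → ℝ) (t : ℝ) (ht : t ∈ Set.Ioo (0 : ℝ) 1)
    (ha1 : ∀ net : NetIn X, ∃ sub : NetIn net.ι,
      Tendsto sub.x atTop atTop ∧
      (⨅ x : X, limsup (fun β => (φ x (net.x (sub.x β)) : EReal)) atTop) ≤ 0)
    (ha2 : ∀ x₁ x₂ : X, ∃ x₃ : X, t * φ x₃ x₁ + (1 - t) * φ x₃ x₂ ≤ 0)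
    (K : ℝ) (hK : 0 ≤ K)
    (ha3 : ∀ x₁ x₂ : X, ∀ y : Y, f x₁ y - f x₂ y ≤ K * φ x₁ x₂) :
    (∀ x₁ x₂ : X, ∃ x₃ : X, ∀ y : Y,
        f x₃ y ≤ t * f x₁ y + (1 - t) * f x₂ y) ∧
      (∀ net : NetIn X,
        (⨅ x : X, ⨆ y : Y, (f x y : EReal)) ≤
          ⨆ y : Y, limsup (fun α => (f (net.x α) y : EReal)) atTop) := by
  obtain ⟨ht0, ht1⟩ := ht
  refine ⟨fun x₁ x₂ => ?_, fun net => ?_⟩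
  · obtain ⟨x₃, h⟩ := ha2 x₁ x₂
    refine ⟨x₃, fun y => ?_⟩
    have h1 := mul_le_mul_of_nonneg_left (ha3 x₃ x₁ y) ht0.le
    have h2 := mul_le_mul_of_nonneg_left (ha3 x₃ x₂ y) (sub_pos.2 ht1).le
    have h3 := mul_nonneg hK (neg_nonneg.2 h)
    nlinarith
  · obtain ⟨sub, hsub, hinf⟩ := ha1 net
    refine le_of_forall_gt_imp_ge_of_dense fun a ha => ?_
    obtain ⟨c, hSc, hca⟩ := EReal.lt_iff_exists_real_btwn.1 ha
    refine le_trans ?_ hca.le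
    obtain ⟨d, hSd, hdc⟩ := EReal.lt_iff_exists_real_btwn.1 hSc
    have hdc' : d < c := EReal.coe_lt_coe_iff.1 hdc
    have hK1 : 0 < K + 1 := by linarith
    have hδ : 0 < (c - d) / (K + 1) := div_pos (by linarith) hK1
    obtain ⟨δ, hδd⟩ : ∃ δ, δ = (c - d) / (K + 1) := ⟨_, rfl⟩
    rw [← hδd] at hδ
    have hδe : δ * (K + 1) = c - d := by rw [hδd]; field_simp
    obtain ⟨x, hx⟩ := iInf_lt_iff.1 (lt_of_le_of_lt hinf (EReal.coe_pos.2 hδ))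
    have hev := eventually_lt_of_limsup_lt hx
    refine (iInf_le _ x).trans (iSup_le fun y => ?_)
    have hy : limsup (fun α => (f (net.x α) y : EReal)) atTop < (d : EReal) :=
      lt_of_le_of_lt (le_iSup (fun y => limsup (fun α => (f (net.x α) y : EReal)) atTop) y) hSd
    have hev2 := hsub.eventually (eventually_lt_of_limsup_lt hy)
    obtain ⟨β, hb1, hb2⟩ := (hev.and hev2).exists
    have hb1' := EReal.coe_lt_coe_iff.1 hb1
    have hb2' := EReal.coe_lt_coe_iff.1 hb2
    have h3 := ha3 x (net.x (sub.x β)) y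
    have h4 := mul_le_mul_of_nonneg_left hb1'.le hK
    exact EReal.coe_le_coe_iff.2 (by nlinarith)
end

section
/- Let X and Y be nonempty sets, ξ : X → ℝ a function bounded from below, and define φ(x,z) := max(ξ(x) − ξ(z), 0) for all x, z ∈ X. Let g : X × Y → ℝ be a function such that for every y ∈ Y the function g(·,y) is bounded on X, and g is s-concavelike on Y for some s ∈ (0,1). Let K ≥ 0 and define f(x,y) := inf_{z∈X} { g(z,y) + K·φ(x,z) } for all x ∈ X, y ∈ Y. Then inf_{x∈X} sup_{y∈Y} f(x,y) = sup_{y∈Y} inf_{x∈X} f(x,y). -/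
open Filter Set

/-- **Example, non-compact minimax equality.** Let `ξ : X → ℝ` be bounded
from below, `φ(x,z) = max(ξ(x) − ξ(z), 0)`, `g : X × Y → ℝ` bounded on `X` for each `y` and
`s`-concavelike on `Y` for some `s ∈ (0,1)`, `K ≥ 0`, and
`f(x,y) = inf_z { g(z,y) + K φ(x,z) }`.  Then `inf_x sup_y f = sup_y inf_x f`. -/
theorem example_minimax_infconv {X Y : Type*} [Nonempty X] [Nonempty Y]
    (ξ : X → ℝ) (hξ : BddBelow (Set.range ξ))
    (g : X → Y → ℝ)
    (hgbdd : ∀ y : Y, ∃ C : ℝ, ∀ x : X, |g x y| ≤ C)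
    (s : ℝ) (hs : s ∈ Set.Ioo (0 : ℝ) 1)
    (hconc : ∀ y₁ y₂ : Y, ∃ y₃ : Y, ∀ x : X,
      s * g x y₁ + (1 - s) * g x y₂ ≤ g x y₃)
    (K : ℝ) (hK : 0 ≤ K)
    (f : X → Y → ℝ)
    (hf : ∀ x y, f x y = ⨅ z : X, (g z y + K * max (ξ x - ξ z) 0)) :
    (⨅ x : X, ⨆ y : Y, (f x y : EReal)) = ⨆ y : Y, ⨅ x : X, (f x y : EReal) := by
  obtain ⟨x₀⟩ := ‹Nonempty X›
  haveI : Nonempty X := ⟨x₀⟩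
  set m : ℝ := ⨅ x, ξ x with hm
  have hmle : ∀ x, m ≤ ξ x := fun x => ciInf_le hξ x
  have hφ : ∀ x z, 0 ≤ K * max (ξ x - ξ z) 0 := fun x z => mul_nonneg hK (le_max_right _ _)
  have hbdd : ∀ x y, BddBelow (Set.range fun z : X => g z y + K * max (ξ x - ξ z) 0) := by
    intro x y
    obtain ⟨C, hC⟩ := hgbdd y
    refine ⟨-C, ?_⟩
    rintro _ ⟨z, rfl⟩
    have h1 := (abs_le.mp (hC z)).1
    have h2 := hφ x z
    show -C ≤ g z y + K * max (ξ x - ξ z) 0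
    linarith
  have key : ∀ x x' y, f x y ≤ f x' y + K * (ξ x - m) := by
    intro x x' y
    rw [← sub_le_iff_le_add, hf x' y]
    refine le_ciInf fun z => ?_
    have h1 : f x y ≤ g z y + K * max (ξ x - ξ z) 0 := by
      rw [hf x y]; exact ciInf_le (hbdd x y) z
    have h2 : K * max (ξ x - ξ z) 0 ≤ K * (ξ x - m) := by
      refine mul_le_mul_of_nonneg_left (max_le ?_ ?_) hK
      · linarith [hmle z]
      · linarith [hmle x]
    linarith [hφ x' z]
  refine le_antisymm ?_ (iSup_iInf_le_iInf_iSup _)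
  rw [← EReal.le_of_forall_lt_iff_le]
  intro c hc
  obtain ⟨w, hw1, hw2⟩ := EReal.lt_iff_exists_real_btwn.mp hc
  have hwc : w < c := EReal.coe_lt_coe_iff.mp hw2
  have hε : 0 < (c - w) / (K + 1) := div_pos (by linarith) (by linarith)
  obtain ⟨x, hx⟩ := exists_lt_of_ciInf_lt (f := ξ) (a := m + (c - w) / (K + 1)) (by linarith)
  have hKx : K * (ξ x - m) ≤ c - w := by
    have h1 : (ξ x - m) * (K + 1) ≤ c - w := by
      rw [← le_div_iff₀ (by linarith)]; linarith
    linarith [hmle x]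
  refine iInf_le_of_le x (iSup_le fun y => ?_)
  have hy : (⨅ x' : X, (f x' y : EReal)) < (w : EReal) :=
    lt_of_le_of_lt (le_iSup (fun y => ⨅ x' : X, (f x' y : EReal)) y) hw1
  obtain ⟨x', hx'⟩ := iInf_lt_iff.mp hy
  have h3 : f x' y < w := EReal.coe_lt_coe_iff.mp hx'
  exact EReal.coe_le_coe_iff.mpr (by linarith [key x x' y])
end

section
/- Let Y be an arbitrary nonempty set, X a compact Hausdorff topological space, and f, g : X × Y → ℝ two functions such that for every y ∈ Y the functions f(·,y) and g(·,y) are bounded on X. Assume: (i) f is t-convexlike on X for some t ∈ (0,1) and, for every y ∈ Y, f(·,y) is lower semicontinuous on X; (ii) g is supinf-concave on Y; (iii) f ≤ g on X × Y. Then inf_{x∈X} sup_{y∈Y} f(x,y) ≤ sup_{y∈Y} inf_{x∈X} g(x,y). -/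
open Filter Set

/-- A closed `t`-convex set is convex. -/
lemma convex_of_closed_tconvex {E : Type*} [AddCommGroup E] [Module ℝ E] [TopologicalSpace E]
    [IsTopologicalAddGroup E] [ContinuousSMul ℝ E] (K : Set E) (hK : IsClosed K)
    (t : ℝ) (ht : t ∈ Set.Ioo (0 : ℝ) 1)
    (h : ∀ a ∈ K, ∀ b ∈ K, t • a + (1 - t) • b ∈ K) : Convex ℝ K := by
  obtain ⟨ht0, ht1⟩ := ht
  rw [convex_iff_segment_subset]
  intro a ha b hb
  rw [segment_eq_image']
  rintro _ ⟨s, hs, rfl⟩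
  let φ : ℝ → E := fun s => a + s • (b - a)
  have hφ : Continuous φ := by fun_prop
  have hT : IsClosed (φ ⁻¹' K) := hK.preimage hφ
  change φ s ∈ K
  obtain ⟨p, ⟨hpK, hp⟩, hpm⟩ := ((isCompact_Icc (a := (0 : ℝ)) (b := s)).inter_left hT).exists_isGreatest
    ⟨0, by simpa [φ] using ha, by simpa using hs.1⟩
  obtain ⟨q, ⟨hqK, hq⟩, hqm⟩ := ((isCompact_Icc (a := s) (b := (1 : ℝ))).inter_left hT).exists_isLeast
    ⟨1, by simpa [φ] using hb, by simpa using hs.2⟩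
  have hr : φ (t * p + (1 - t) * q) ∈ K := by
    have := h _ hpK _ hqK
    convert this using 1
    simp only [φ]
    module
  by_contra hsK
  have hps : p < s := lt_of_le_of_ne hp.2 (fun e => hsK (e ▸ hpK))
  have hsq : s < q := lt_of_le_of_ne hq.1 (fun e => hsK (e ▸ hqK))
  rcases le_total (t * p + (1 - t) * q) s with hle | hle
  · have := hpm ⟨hr, by nlinarith [hp.1], hle⟩
    nlinarith
  · have := hqm ⟨hr, hle, by nlinarith [hq.2]⟩
    nlinarith

/-- The finite-dimensional separation step. -/
lemma exists_weights {X : Type*} [Nonempty X] {n : ℕ} (F : X → Fin n → ℝ) (c t : ℝ)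
    (ht : t ∈ Set.Ioo (0 : ℝ) 1)
    (hconv : ∀ x₁ x₂ : X, ∃ x₃ : X, ∀ i, F x₃ i ≤ t * F x₁ i + (1 - t) * F x₂ i)
    (hc : ∀ x, ∃ i, c < F x i) :
    ∃ lam ∈ stdSimplex ℝ (Fin n), ∀ x, c ≤ ∑ i, lam i * F x i := by
  obtain ⟨x0⟩ := ‹Nonempty X›
  let D : Set (Fin n → ℝ) := {z | ∃ x, ∀ i, F x i ≤ z i}
  let A : Set (Fin n → ℝ) := Set.univ.pi fun _ => Set.Iio c
  have hAo : IsOpen A := isOpen_set_pi Set.finite_univ fun _ _ => isOpen_Iio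
  have hAc : Convex ℝ A := convex_pi fun _ _ => convex_Iio c
  have hD : ∀ a ∈ D, ∀ b ∈ D, t • a + (1 - t) • b ∈ D := by
    rintro a ⟨x, hx⟩ b ⟨y, hy⟩
    obtain ⟨z, hz⟩ := hconv x y
    refine ⟨z, fun i => (hz i).trans ?_⟩
    simp only [Pi.add_apply, Pi.smul_apply, smul_eq_mul]
    have h1 := mul_le_mul_of_nonneg_left (hx i) ht.1.le
    have h2 := mul_le_mul_of_nonneg_left (hy i) (sub_nonneg.2 ht.2.le)
    linarith
  have hcD : Convex ℝ (closure D) := by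
    refine convex_of_closed_tconvex _ isClosed_closure t ht fun a ha b hb => ?_
    exact map_mem_closure₂ (f := fun a b : Fin n → ℝ => t • a + (1 - t) • b)
      (by fun_prop) ha hb hD
  have hdisj : Disjoint A (closure D) := by
    refine Disjoint.closure_right ?_ hAo
    rw [Set.disjoint_left]
    rintro z hz ⟨x, hx⟩
    obtain ⟨i, hi⟩ := hc x
    have := hz i trivial
    simp only [Set.mem_Iio] at this
    linarith [hx i]
  obtain ⟨l, u, hlA, hlD⟩ := geometric_hahn_banach_open hAc hAo hcD hdisj
  let w : Fin n → ℝ := fun i => l (Pi.single i 1)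
  have hl : ∀ z, l z = ∑ i, w i * z i := by
    intro z
    have hz : z = ∑ i, z i • (Pi.single i 1 : Fin n → ℝ) := by
      ext j
      simp [Finset.sum_apply, Pi.single_apply]
    conv_lhs => rw [hz]
    simp [w, map_sum, mul_comm]
  have hw : ∀ i, 0 ≤ w i := by
    intro i
    by_contra hneg
    push Not at hneg
    have key : ∀ r : ℝ, 0 ≤ r → u ≤ l (F x0) + r * w i := by
      intro r hr
      have := hlD (F x0 + r • Pi.single i 1) (subset_closure ⟨x0, fun j => ?_⟩)
      · simpa [w] using this
      · by_cases hj : j = i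
        · subst hj; simpa using hr
        · simp [hj]
    have h0 := key 0 le_rfl
    have h1 := key ((l (F x0) - u + 1) / (- w i)) (div_nonneg (by linarith) (by linarith))
    have : (l (F x0) - u + 1) / (- w i) * w i = - (l (F x0) - u + 1) := by
      field_simp [hneg.ne]
    linarith
  have hA : ∀ ε > 0, (c - ε) * ∑ i, w i < u := by
    intro ε hε
    have := hlA (fun _ => c - ε) (fun i _ => by simpa using hε)
    rwa [hl, ← Finset.sum_mul, mul_comm] at this
  have hDx : ∀ x, u ≤ ∑ i, w i * F x i := fun x => by
    rw [← hl]; exact hlD _ (subset_closure ⟨x, fun _ => le_rfl⟩)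
  have hW0 : 0 ≤ ∑ i, w i := Finset.sum_nonneg fun i _ => hw i
  have hW : 0 < ∑ i, w i := by
    refine lt_of_le_of_ne hW0 fun h => ?_
    have hz := (Finset.sum_eq_zero_iff_of_nonneg (fun i _ => hw i)).1 h.symm
    have h1 := hA 1 one_pos
    rw [← h] at h1
    have h2 := hDx x0
    rw [Finset.sum_eq_zero (fun i hi => by rw [hz i hi, zero_mul])] at h2
    linarith
  have hcu : c * ∑ i, w i ≤ u := by
    by_contra hlt
    push Not at hlt
    have := hA ((c * ∑ i, w i - u) / ∑ i, w i) (div_pos (by linarith) hW)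
    rw [sub_mul, div_mul_cancel₀ _ hW.ne'] at this
    linarith
  refine ⟨fun i => w i / ∑ j, w j, ⟨fun i => div_nonneg (hw i) hW0, ?_⟩, fun x => ?_⟩
  · rw [← Finset.sum_div, div_self hW.ne']
  · have : ∑ i, w i / (∑ j, w j) * F x i = (∑ i, w i * F x i) / ∑ j, w j := by
      rw [Finset.sum_div]
      exact Finset.sum_congr rfl fun i _ => by ring
    rw [this, le_div_iff₀ hW]
    exact hcu.trans (hDx x)

/-- **Simons / Fan minimax theorem.** Let `X` be a compact Hausdorff space,
`Y` a nonempty set, `f, g : X × Y → ℝ` bounded on `X` for each `y`, `f` `t`-convexlike on `X`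
for some `t ∈ (0,1)` and lower semicontinuous in `x`, `g` supinf-concave on `Y`, and `f ≤ g`.
Then `inf_x sup_y f(x,y) ≤ sup_y inf_x g(x,y)`. -/
theorem simons_minimax {X Y : Type*} [TopologicalSpace X] [CompactSpace X] [T2Space X]
    [Nonempty X] [Nonempty Y]
    (f g : X → Y → ℝ)
    (hfbdd : ∀ y : Y, ∃ C : ℝ, ∀ x : X, |f x y| ≤ C)
    (hgbdd : ∀ y : Y, ∃ C : ℝ, ∀ x : X, |g x y| ≤ C)
    (t : ℝ) (ht : t ∈ Set.Ioo (0 : ℝ) 1)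
    (hconv : ∀ x₁ x₂ : X, ∃ x₃ : X, ∀ y : Y,
      f x₃ y ≤ t * f x₁ y + (1 - t) * f x₂ y)
    (hlsc : ∀ y : Y, LowerSemicontinuous fun x : X => f x y)
    (hconc : (⨆ y : Y, ⨅ x : X, (g x y : EReal)) =
      ⨆ (n : ℕ) (_ : 0 < n) (ys : Fin n → Y) (lam : Fin n → ℝ)
        (_ : lam ∈ stdSimplex ℝ (Fin n)),
        ⨅ x : X, ((∑ i, lam i * g x (ys i) : ℝ) : EReal))
    (hfg : ∀ x y, f x y ≤ g x y) :
    (⨅ x : X, ⨆ y : Y, (f x y : EReal)) ≤ ⨆ y : Y, ⨅ x : X, (g x y : EReal) := by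
  by_contra hlt
  push Not at hlt
  obtain ⟨c, hc1, hc2⟩ := EReal.lt_iff_exists_real_btwn.1 hlt
  have hcov : ∀ x, ∃ y, c < f x y := by
    intro x
    have := hc2.trans_le (iInf_le _ x)
    obtain ⟨y, hy⟩ := lt_iSup_iff.1 this
    exact ⟨y, EReal.coe_lt_coe_iff.1 hy⟩
  obtain ⟨s, hs⟩ := isCompact_univ.elim_finite_subcover (fun y : Y => {x | c < f x y})
    (fun y => (hlsc y).isOpen_preimage c) (fun x _ => by simpa using hcov x)
  have hs' : ∀ x, ∃ y ∈ s, c < f x y := fun x => by simpa using hs (Set.mem_univ x)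
  let ys : Fin s.card → Y := fun i => (s.equivFin.symm i : Y)
  have hys : ∀ x, ∃ i, c < f x (ys i) := by
    intro x
    obtain ⟨y, hy, hxy⟩ := hs' x
    exact ⟨s.equivFin ⟨y, hy⟩, by simpa [ys] using hxy⟩
  obtain ⟨lam, hlam, hle⟩ := exists_weights (fun x i => f x (ys i)) c t ht
    (fun x₁ x₂ => (hconv x₁ x₂).imp fun x₃ h i => h (ys i)) hys
  have hn : 0 < s.card := by
    obtain ⟨x0⟩ := ‹Nonempty X›
    obtain ⟨i, _⟩ := hys x0
    exact i.pos
  have hfin : (c : EReal) ≤ ⨅ x : X, ((∑ i, lam i * g x (ys i) : ℝ) : EReal) := by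
    refine le_iInf fun x => EReal.coe_le_coe_iff.2 ((hle x).trans ?_)
    exact Finset.sum_le_sum fun i _ => mul_le_mul_of_nonneg_left (hfg x (ys i)) (hlam.1 i)
  rw [hconc] at hc1
  refine absurd hc1 (not_lt.2 (hfin.trans ?_))
  exact le_iSup_of_le s.card (le_iSup_of_le hn (le_iSup_of_le ys (le_iSup_of_le lam
    (le_iSup_of_le hlam le_rfl))))
end

section
/- Let Ω be a completely regular Hausdorff pseudocompact topological space and Φ a nonempty subset of C(Ω) such that conv(Φ), the convex hull of Φ, is uniformly bounded and relatively compact in C(Ω) for the topology τ_p of pointwise convergence on Ω. Then inf over all φ in the τ_p-closure of conv(Φ) of sup_{u∈Ω} φ(u) equals inf over all φ ∈ conv(Φ) of sup_{u∈Ω} φ(u). -/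
open Filter Set

/-- A topological space is pseudocompact if every continuous real-valued function
on it is bounded. -/
def Pseudocompact (X : Type*) [TopologicalSpace X] : Prop :=
  ∀ g : C(X, ℝ), ∃ C : ℝ, ∀ x : X, |g x| ≤ C

open Topology

theorem psc_max {Ω : Type*} [TopologicalSpace Ω] [Nonempty Ω] (hΩ : Pseudocompact Ω)
    (h : Ω → ℝ) (hc : Continuous h) : ∃ u, ∀ v, h v ≤ h u := by
  obtain ⟨C, hC⟩ := hΩ ⟨h, hc⟩
  have hC' : ∀ x, |h x| ≤ C := hC
  have hbdd : BddAbove (range h) := ⟨C, by rintro _ ⟨x, rfl⟩; exact (abs_le.1 (hC' x)).2⟩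
  by_contra hcon
  push Not at hcon
  set s := ⨆ u, h u with hs
  have hlt : ∀ u, 0 < s - h u := by
    intro u
    obtain ⟨v, hv⟩ := hcon u
    have := le_ciSup hbdd v
    linarith
  obtain ⟨B, hB⟩ := hΩ ⟨fun u => (s - h u)⁻¹,
    (continuous_const.sub hc).inv₀ (fun u => (hlt u).ne')⟩
  have hB' : ∀ u, (s - h u)⁻¹ ≤ B := fun u => (le_abs_self _).trans (hB u)
  have hBpos : 0 < B := (inv_pos.2 (hlt (Classical.arbitrary Ω))).trans_le (hB' _)
  have : s ≤ s - B⁻¹ := by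
    apply ciSup_le
    intro u
    have := inv_le_of_inv_le₀ (hlt u) (hB' u)
    linarith
  have := inv_pos.2 hBpos
  linarith

/-- countable common zeros from approximate common zeros -/
theorem psc_zero {Ω : Type*} [TopologicalSpace Ω] (hΩ : Pseudocompact Ω)
    (f : ℕ → Ω → ℝ) (hf : ∀ i, Continuous (f i))
    (happ : ∀ n : ℕ, ∀ ε > 0, ∃ v, ∀ i < n, |f i v| < ε) : ∃ w, ∀ i, f i w = 0 := by
  have hne : Nonempty Ω := ⟨(happ 0 1 one_pos).choose⟩
  set F : ℕ → Ω → ℝ := fun i v => (1/2 : ℝ)^(i+1) * min 1 |f i v| with hF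
  have hFc : ∀ i, Continuous (F i) := fun i =>
    continuous_const.mul (continuous_const.min (hf i).abs)
  have hF0 : ∀ i v, 0 ≤ F i v := fun i v => by simp only [hF]; positivity
  have hF1 : ∀ i v, F i v ≤ (1/2 : ℝ)^(i+1) := fun i v => by
    have : min 1 |f i v| ≤ 1 := min_le_left _ _
    have h2 : (0:ℝ) < (1/2 : ℝ)^(i+1) := by positivity
    simp only [hF]; nlinarith
  have hg : HasSum (fun i : ℕ => (1/2 : ℝ)^(i+1)) 1 := by
    have := hasSum_geometric_two.mul_left (1/2 : ℝ)
    simpa [pow_succ, mul_comm] using this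
  have hsum : ∀ v, Summable (fun i => F i v) := fun v =>
    Summable.of_nonneg_of_le (fun i => hF0 i v) (fun i => hF1 i v) hg.summable
  have hcont : Continuous (fun v => ∑' i, F i v) :=
    continuous_tsum hFc hg.summable (fun i v => by
      rw [Real.norm_of_nonneg (hF0 i v)]; exact hF1 i v)
  obtain ⟨w, hw⟩ := psc_max hΩ (fun v => - ∑' i, F i v) hcont.neg
  have key : ∑' i, F i w ≤ 0 := by
    apply le_of_forall_pos_le_add
    intro ε hε
    obtain ⟨n, hn⟩ := exists_pow_lt_of_lt_one (half_pos hε) (by norm_num : (1/2:ℝ) < 1)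
    obtain ⟨v, hv⟩ := happ n (ε/2) (half_pos hε)
    have h1 : ∑' i, F i w ≤ ∑' i, F i v := by have := hw v; linarith
    have h2 : HasSum (fun i : ℕ => (1/2 : ℝ)^(i+1) * (ε/2)) (1 * (ε/2)) := hg.mul_right _
    have h3 : ∑ i ∈ Finset.range n, F i v ≤ ε/2 := by
      calc _ ≤ ∑ i ∈ Finset.range n, (1/2 : ℝ)^(i+1) * (ε/2) := by
            apply Finset.sum_le_sum
            intro i hi
            have := hv i (Finset.mem_range.1 hi)
            simp only [hF]
            gcongr
            exact (min_le_right _ _).trans this.le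
        _ ≤ 1 * (ε/2) := sum_le_hasSum _ (fun i _ => by positivity) h2
        _ = ε/2 := one_mul _
    have h4 : ∑' i, F (i+n) v ≤ ε/2 := by
      have h5 : HasSum (fun i : ℕ => (1/2 : ℝ)^(i+1) * (1/2)^n) (1 * (1/2)^n) := hg.mul_right _
      have := ((summable_nat_add_iff n).2 (hsum v)).hasSum
      have h6 := hasSum_le (fun i => (hF1 (i+n) v).trans (le_of_eq
        (by ring : (1/2 : ℝ)^(i+n+1) = (1/2 : ℝ)^(i+1) * (1/2)^n))) this h5
      linarith
    have := (hsum v).sum_add_tsum_nat_add n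
    linarith
  refine ⟨w, fun i => ?_⟩
  have h1 : F i w ≤ ∑' i, F i w := (hsum w).le_tsum i (fun j _ => hF0 j w)
  have h2 : F i w = 0 := le_antisymm (h1.trans key) (hF0 i w)
  simp only [hF] at h2
  rcases mul_eq_zero.1 h2 with h | h
  · exact absurd h (by positivity)
  · by_contra h3
    have : 0 < min 1 |f i w| := lt_min one_pos (abs_pos.2 h3)
    linarith

theorem exists_net {Ω : Type*} (M : ℝ) (E : Finset (Ω → ℝ)) (hE : ∀ f ∈ E, ∀ u, |f u| ≤ M)
    (ε : ℝ) (hε : 0 < ε) : ∃ N : Finset Ω, ∀ u, ∃ v ∈ N, ∀ f ∈ E, |f v - f u| < ε := by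
  classical
  rcases isEmpty_or_nonempty Ω with hemp | hnem
  · exact ⟨∅, fun u => hemp.elim u⟩
  let T : Ω → (E → ℝ) := fun u f => f.1 u
  have htb : TotallyBounded (range T) := by
    apply (isCompact_closedBall (0 : E → ℝ) |M|).totallyBounded.subset
    rintro _ ⟨u, rfl⟩
    rw [mem_closedBall_zero_iff, pi_norm_le_iff_of_nonneg (abs_nonneg _)]
    intro f
    exact (hE f.1 f.2 u).trans (le_abs_self _)
  obtain ⟨t, hts, htf, ht⟩ := Metric.finite_approx_of_totallyBounded htb ε hε
  have hts' : ∀ y ∈ t, ∃ u, T u = y := fun y hy => hts hy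
  choose! p hp using hts'
  refine ⟨(htf.image p).toFinset, fun u => ?_⟩
  obtain ⟨y, hy, hyu⟩ := mem_iUnion₂.1 (ht (mem_range_self u))
  refine ⟨p y, by simpa using ⟨y, hy, rfl⟩, fun f hf => ?_⟩
  have h1 := (dist_pi_lt_iff hε).1 (Metric.mem_ball.1 hyu) ⟨f, hf⟩
  rw [← hp y hy, dist_comm] at h1
  exact h1

theorem exists_seq_tendsto {Ω : Type*} [TopologicalSpace Ω] (hΩ : Pseudocompact Ω)
    (K : Set (Ω → ℝ)) (M : ℝ) (hM : ∀ g ∈ closure K, ∀ u, |g u| ≤ M)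
    (hcpt : IsCompact (closure K)) (hcont : ∀ g ∈ closure K, Continuous g)
    (ψ : Ω → ℝ) (hψ : ψ ∈ closure K) :
    ∃ φ : ℕ → Ω → ℝ, (∀ n, φ n ∈ K) ∧ ∀ u, Tendsto (fun n => φ n u) atTop (𝓝 (ψ u)) := by
  classical
  have hP : ∀ (n : ℕ) (F : Finset Ω), ∃ g ∈ K, ∀ v ∈ F, |g v - ψ v| < 1 / ((n:ℝ)+1) := by
    intro n F
    have ho : IsOpen {g : Ω → ℝ | ∀ v ∈ F, |g v - ψ v| < 1 / ((n:ℝ)+1)} := by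
      have : {g : Ω → ℝ | ∀ v ∈ F, |g v - ψ v| < 1 / ((n:ℝ)+1)}
        = ⋂ v ∈ F, {g : Ω → ℝ | |g v - ψ v| < 1 / ((n:ℝ)+1)} := by ext; simp
      rw [this]
      apply isOpen_biInter_finset
      intro v _
      exact isOpen_lt (by fun_prop) continuous_const
    obtain ⟨g, hg, hgK⟩ := mem_closure_iff.1 hψ _ ho (fun v _ => by simp; positivity)
    exact ⟨g, hgK, hg⟩
  choose P hPK hP using hP
  have hN : ∀ (n : ℕ) (E : Finset (Ω → ℝ)), ∃ N : Finset Ω, (∀ f ∈ E, ∀ u, |f u| ≤ M) →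
      ∀ u, ∃ v ∈ N, ∀ f ∈ E, |f v - f u| < 1 / ((n:ℝ)+1) := by
    intro n E
    by_cases hE : ∀ f ∈ E, ∀ u, |f u| ≤ M
    · obtain ⟨N, hN⟩ := exists_net M E hE (1 / ((n:ℝ)+1)) (by positivity)
      exact ⟨N, fun _ => hN⟩
    · exact ⟨∅, fun h => absurd h hE⟩
  choose N hN using hN
  let st : ℕ → Finset (Ω → ℝ) × Finset Ω := fun n => Nat.rec ({ψ}, ∅)
    (fun n s => (insert (P n s.2) s.1, s.2 ∪ N n (insert (P n s.2) s.1))) n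
  let φ : ℕ → Ω → ℝ := fun n => P n (st n).2
  have hst1 : ∀ n, (st (n+1)).1 = insert (φ n) (st n).1 := fun n => rfl
  have hst2 : ∀ n, (st (n+1)).2 = (st n).2 ∪ N n (st (n+1)).1 := fun n => rfl
  have hφK : ∀ n, φ n ∈ K := fun n => hPK _ _
  have hmono1 : Monotone fun n => (st n).1 := monotone_nat_of_le_succ fun n => by
    rw [hst1]; exact Finset.subset_insert _ _
  have hmono2 : Monotone fun n => (st n).2 := monotone_nat_of_le_succ fun n => by
    rw [hst2]; exact Finset.subset_union_left
  have hbd : ∀ n, ∀ f ∈ (st n).1, ∀ u, |f u| ≤ M := by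
    intro n
    induction n with
    | zero => 
      intro f hf
      have : f = ψ := by simpa [st] using hf
      exact this ▸ hM ψ hψ
    | succ n ih =>
      intro f hf
      rw [hst1, Finset.mem_insert] at hf
      rcases hf with rfl | hf
      · exact hM _ (subset_closure (hφK n))
      · exact ih f hf
  have hψst : ∀ n, ψ ∈ (st n).1 := fun n => hmono1 (Nat.zero_le n) (by simp [st])
  have hφst : ∀ i n, i < n → φ i ∈ (st n).1 := fun i n hin =>
    hmono1 (Nat.succ_le_of_lt hin) (by
      change φ i ∈ (st (i+1)).1
      rw [hst1]; exact Finset.mem_insert_self _ _)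
  have hD : ∀ m, ∀ v ∈ (st m).2, Tendsto (fun n => φ n v) atTop (𝓝 (ψ v)) := by
    intro m v hv
    rw [tendsto_iff_dist_tendsto_zero]
    refine squeeze_zero' (Eventually.of_forall fun _ => dist_nonneg) ?_
      tendsto_one_div_add_atTop_nhds_zero_nat
    filter_upwards [eventually_ge_atTop m] with n hn
    exact (hP n _ v (hmono2 hn hv)).le
  refine ⟨φ, hφK, fun u => ?_⟩
  by_contra hcon
  rw [Metric.tendsto_atTop] at hcon
  push Not at hcon
  obtain ⟨ε, hε, hfr⟩ := hcon
  have hfreq : ∃ᶠ n in atTop, ε ≤ dist (φ n u) (ψ u) := by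
    rw [frequently_atTop]
    intro a
    obtain ⟨b, hb, h⟩ := hfr a
    exact ⟨b, hb, h⟩
  have : NeBot (atTop ⊓ 𝓟 {n : ℕ | ε ≤ dist (φ n u) (ψ u)}) := 
    frequently_mem_iff_neBot.1 hfreq
  let U := Ultrafilter.of (atTop ⊓ 𝓟 {n : ℕ | ε ≤ dist (φ n u) (ψ u)})
  have hU : (U : Filter ℕ) ≤ atTop ⊓ 𝓟 {n : ℕ | ε ≤ dist (φ n u) (ψ u)} := Ultrafilter.of_le _
  have hU1 : (U : Filter ℕ) ≤ atTop := hU.trans inf_le_left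
  have hU2 : ∀ᶠ n in (U : Filter ℕ), ε ≤ dist (φ n u) (ψ u) :=
    le_principal_iff.1 (hU.trans inf_le_right)
  obtain ⟨g, hgK, hg⟩ := hcpt.ultrafilter_le_nhds (U.map φ) (by
    rw [le_principal_iff]
    exact Filter.mem_map.2 (Eventually.of_forall fun n => subset_closure (hφK n)))
  have hgt : Tendsto φ U (𝓝 g) := hg
  rw [tendsto_pi_nhds] at hgt
  have hgD : ∀ m, ∀ v ∈ (st m).2, g v = ψ v := fun m v hv =>
    tendsto_nhds_unique (hgt v) ((hD m v hv).mono_left hU1)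
  have hgu : ε ≤ dist (g u) (ψ u) := ge_of_tendsto ((hgt u).dist tendsto_const_nhds) hU2
  obtain ⟨w, hw⟩ := psc_zero hΩ
    (fun i v => match i with
      | 0 => ψ v - ψ u
      | 1 => g v - ψ v
      | i+2 => φ i v - φ i u)
    (by
      intro i
      match i with
      | 0 => exact (hcont ψ hψ).sub continuous_const
      | 1 => exact (hcont g hgK).sub (hcont ψ hψ)
      | i+2 => exact (hcont _ (subset_closure (hφK i))).sub continuous_const)
    (by
      intro n δ hδ
      obtain ⟨m, hm⟩ := exists_nat_one_div_lt hδ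
      let k := max n m
      have hk : 1 / ((k:ℝ)+1) < δ := by
        refine lt_of_le_of_lt ?_ hm
        apply one_div_le_one_div_of_le (by positivity)
        have : (m:ℝ) ≤ k := by exact_mod_cast le_max_right n m
        linarith
      obtain ⟨v, hvN, hv⟩ := hN k (st (k+1)).1 (hbd (k+1)) u
      have hvD : v ∈ (st (k+1)).2 := by
        rw [hst2]; exact Finset.mem_union_right _ hvN
      refine ⟨v, fun i hi => ?_⟩
      match i with
      | 0 => exact (hv ψ (hψst (k+1))).trans hk
      | 1 => simpa [hgD (k+1) v hvD] using hδ
      | i+2 =>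
        refine (hv (φ i) (hφst i (k+1) ?_)).trans hk
        have := le_max_left n m
        omega)
  have h0 : ψ w - ψ u = 0 := hw 0
  have h1 : g w - ψ w = 0 := hw 1
  have h2 : ∀ i, φ i w - φ i u = 0 := fun i => hw (i+2)
  have h3 : g w = g u := by
    refine tendsto_nhds_unique (hgt w) ((hgt u).congr fun i => ?_)
    have := h2 i
    linarith
  have : g u = ψ u := by linarith
  rw [this, dist_self] at hgu
  linarith

theorem approx_min {α : Type*} (D : Set α) (hD : D.Nonempty) (σ : α → ℝ) (B : ℝ)
    (hB : ∀ x ∈ D, B ≤ σ x) (η : ℝ) (hη : 0 < η) : ∃ x ∈ D, ∀ y ∈ D, σ x ≤ σ y + η := by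
  have hbb : BddBelow (σ '' D) := ⟨B, by rintro _ ⟨x, hx, rfl⟩; exact hB x hx⟩
  obtain ⟨_, ⟨x, hx, rfl⟩, h⟩ := exists_lt_of_csInf_lt (hD.image σ)
    (lt_add_of_pos_right (sInf (σ '' D)) hη)
  refine ⟨x, hx, fun y hy => ?_⟩
  have := csInf_le hbb (mem_image_of_mem σ hy)
  linarith

/-- Simons-type inequality. -/
theorem simons {Ω : Type*} [TopologicalSpace Ω] (hΩ : Pseudocompact Ω)
    (C : ℕ → Set (Ω → ℝ)) (hanti : Antitone C) (hconv : ∀ n, Convex ℝ (C n))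
    (hne : ∀ n, (C n).Nonempty) (M : ℝ) (hM : ∀ g ∈ C 0, ∀ u, |g u| ≤ M)
    (hc : ∀ g ∈ C 0, Continuous g) (b : ℝ) (hb : ∀ u, ∃ n, ∀ g ∈ C n, g u ≤ b)
    (ε : ℝ) (hε : 0 < ε) : ∃ g ∈ C 0, ∀ u, g u ≤ b + ε := by
  rcases isEmpty_or_nonempty Ω with hemp | hnem
  · obtain ⟨g, hg⟩ := hne 0
    exact ⟨g, hg, fun u => hemp.elim u⟩
  by_contra hcon
  push Not at hcon
  let u0 : Ω := Classical.arbitrary Ω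
  have hMn : ∀ n, ∀ g ∈ C n, ∀ u, |g u| ≤ M := fun n g hg => hM g (hanti (Nat.zero_le n) hg)
  have hM0 : 0 ≤ M := by
    obtain ⟨g, hg⟩ := hne 0
    exact (abs_nonneg _).trans (hM g hg u0)
  set δ := ε / 4 with hδ
  let S : (Ω → ℝ) → ℝ := fun f => ⨆ u, f u
  have hG : ∀ (n : ℕ) (h : Ω → ℝ), ∃ g ∈ C (n+1), (∃ B, ∀ u, |h u| ≤ B) → ∀ g' ∈ C (n+1),
      S (h + (1/2:ℝ)^n • g) ≤ S (h + (1/2:ℝ)^n • g') + δ * (1/4)^n := by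
    intro n h
    by_cases hB : ∃ B, ∀ u, |h u| ≤ B
    · obtain ⟨B, hB⟩ := hB
      obtain ⟨g, hg, h'⟩ := approx_min (C (n+1)) (hne _) (fun g => S (h + (1/2:ℝ)^n • g))
        (h u0 - (1/2:ℝ)^n * M) (by
          intro g hg
          have hbd : BddAbove (range (h + (1/2:ℝ)^n • g)) := by
            refine ⟨B + (1/2:ℝ)^n * M, ?_⟩
            rintro _ ⟨u, rfl⟩
            have h1 := (abs_le.1 (hB u)).2
            have h2 := (abs_le.1 (hMn _ g hg u)).2
            simp only [Pi.add_apply, Pi.smul_apply, smul_eq_mul]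
            gcongr
          have h3 := le_ciSup hbd u0
          refine le_trans ?_ h3
          have h2 := (abs_le.1 (hMn _ g hg u0)).1
          simp only [Pi.add_apply, Pi.smul_apply, smul_eq_mul]
          have : (1/2:ℝ)^n * (-M) ≤ (1/2:ℝ)^n * g u0 := by gcongr
          linarith) (δ * (1/4)^n) (by positivity)
      exact ⟨g, hg, fun _ => h'⟩
    · obtain ⟨g, hg⟩ := hne (n+1)
      exact ⟨g, hg, fun h => absurd h hB⟩
  choose G hGC hG using hG
  let H : ℕ → Ω → ℝ := fun n => Nat.rec 0 (fun n h => h + (1/2:ℝ)^(n+1) • G n h) n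
  let g : ℕ → Ω → ℝ := fun n => G n (H n)
  have hgC : ∀ n, g n ∈ C (n+1) := fun n => hGC _ _
  have hgM : ∀ n u, |g n u| ≤ M := fun n => hMn _ _ (hgC n)
  have hH0 : H 0 = 0 := rfl
  have hHs : ∀ n, H (n+1) = H n + (1/2:ℝ)^(n+1) • g n := fun n => rfl
  have hHb : ∀ n, ∃ B, ∀ u, |H n u| ≤ B := by
    intro n
    induction n with
    | zero => exact ⟨0, fun u => by simp [hH0]⟩
    | succ n ih =>
      obtain ⟨B, hB⟩ := ih
      refine ⟨B + (1/2:ℝ)^(n+1) * M, fun u => ?_⟩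
      rw [hHs]
      simp only [Pi.add_apply, Pi.smul_apply, smul_eq_mul]
      refine (abs_add_le _ _).trans ?_
      rw [abs_mul, abs_of_nonneg (by positivity : (0:ℝ) ≤ (1/2:ℝ)^(n+1))]
      gcongr
      · exact hB u
      · exact hgM n u
  have hHbd : ∀ n, ∀ g' ∈ C 0, BddAbove (range (H n + (1/2:ℝ)^n • g')) := by
    intro n g' hg'
    obtain ⟨B, hB⟩ := hHb n
    refine ⟨B + (1/2:ℝ)^n * M, ?_⟩
    rintro _ ⟨u, rfl⟩
    have h1 := (abs_le.1 (hB u)).2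
    have h2 := (abs_le.1 (hM g' hg' u)).2
    simp only [Pi.add_apply, Pi.smul_apply, smul_eq_mul]
    gcongr
  have hC0 : ∀ n, C n ⊆ C 0 := fun n => hanti (Nat.zero_le n)
  -- halving
  have hhalf : ∀ m, ∀ g' ∈ C (m+2), ∃ g'' ∈ C (m+1),
      H (m+1) + (1/2:ℝ)^(m+1) • g' = H m + (1/2:ℝ)^m • g'' := by
    intro m g' hg'
    refine ⟨(1/2:ℝ) • g m + (1/2:ℝ) • g', hconv _ (hgC m) (hanti (by omega) hg')
      (by norm_num) (by norm_num) (by norm_num), ?_⟩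
    rw [hHs]
    ext u
    simp only [Pi.add_apply, Pi.smul_apply, smul_eq_mul]
    ring
  have hP : ∀ n k, ∀ g' ∈ C (n+k+1),
      S (H n + (1/2:ℝ)^n • g n) ≤ S (H (n+k) + (1/2:ℝ)^(n+k) • g') + δ * (1/4)^n := by
    intro n k
    induction k with
    | zero => intro g' hg'; exact hG n (H n) (hHb n) g' hg'
    | succ k ih =>
      intro g' hg'
      obtain ⟨g'', hg'', he⟩ := hhalf (n+k) g' hg'
      rw [← add_assoc n k 1, he]
      exact ih g'' hg''
  have ha : ∀ m, ∀ g' ∈ C (m+1), b + ε ≤ S (H m + (1/2:ℝ)^m • g') := by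
    intro m
    induction m with
    | zero =>
      intro g' hg'
      obtain ⟨u, hu⟩ := hcon g' (hC0 _ hg')
      have := le_ciSup (hHbd 0 g' (hC0 _ hg')) u
      refine le_trans ?_ this
      simpa [hH0] using hu.le
    | succ m ih =>
      intro g' hg'
      obtain ⟨g'', hg'', he⟩ := hhalf m g' hg'
      rw [he]
      exact ih g'' hg''
  -- the limit
  let F : ℕ → Ω → ℝ := fun j u => (1/2:ℝ)^(j+1) * g j u
  have hFb : ∀ j u, |F j u| ≤ (1/2:ℝ)^(j+1) * M := by
    intro j u
    simp only [F]
    rw [abs_mul, abs_of_nonneg (by positivity : (0:ℝ) ≤ (1/2:ℝ)^(j+1))]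
    gcongr
    exact hgM j u
  have hgeo : ∀ (n : ℕ) (c : ℝ), HasSum (fun j : ℕ => (1/2:ℝ)^(j+n+1) * c) ((1/2)^n * c) := by
    intro n c
    have := hasSum_geometric_two.mul_left ((1/2 : ℝ)^(n+1) * c)
    have e1 : (fun j : ℕ => (1/2:ℝ)^(j+n+1) * c)
        = fun j : ℕ => (1/2 : ℝ)^(n+1) * c * (1/2)^j := by
      ext j; ring
    have e2 : (1/2:ℝ)^n * c = (1/2 : ℝ)^(n+1) * c * 2 := by ring
    rw [e1, e2]
    exact this
  have hFsum : ∀ u, Summable (fun j => F j u) := fun u =>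
    Summable.of_norm_bounded (hgeo 0 M).summable (fun j => hFb j u)
  have hHF : ∀ n u, H n u = ∑ j ∈ Finset.range n, F j u := by
    intro n u
    induction n with
    | zero => simp [hH0]
    | succ n ih => rw [Finset.sum_range_succ, ← ih, hHs]; rfl
  let h : Ω → ℝ := fun u => ∑' j, F j u
  have htail : ∀ n u, HasSum (fun j => F (j+n) u) (h u - H n u) := by
    intro n u
    have h1 := (hFsum u).sum_add_tsum_nat_add n
    have h2 := ((summable_nat_add_iff n).2 (hFsum u)).hasSum
    have e : h u - H n u = ∑' j, F (j+n) u := by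
      rw [hHF]
      simp only [h]
      linarith
    rw [e]
    exact h2
  have hhc : Continuous h := continuous_tsum
    (fun j => continuous_const.mul (hc _ (hC0 _ (hgC j)))) (hgeo 0 M).summable
    (fun j u => hFb j u)
  obtain ⟨u, hu⟩ := psc_max hΩ h hhc
  have hSle : ∀ m, S (H m + (1/2:ℝ)^m • g m) ≤ h u + 2 * M * (1/2)^m := by
    intro m
    apply ciSup_le
    intro v
    simp only [Pi.add_apply, Pi.smul_apply, smul_eq_mul]
    have h1 := hu v
    have h2 : -((1/2:ℝ)^m * M) ≤ h v - H m v := by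
      have := hasSum_le (fun j => (abs_le.1 (hFb (j+m) v)).1) (hgeo m M).neg (htail m v)
      exact this
    have h3 : (1/2:ℝ)^m * g m v ≤ (1/2:ℝ)^m * M := by
      gcongr
      exact (abs_le.1 (hgM m v)).2
    linarith
  have hlim : Tendsto (fun m : ℕ => h u + 2 * M * (1/2:ℝ)^m) atTop (𝓝 (h u)) := by
    have := (tendsto_pow_atTop_nhds_zero_of_lt_one (by norm_num : (0:ℝ) ≤ 1/2)
      (by norm_num : (1/2:ℝ) < 1)).const_mul (2*M)
    simpa using this.const_add (h u)
  have hau : b + ε ≤ h u := ge_of_tendsto' hlim (fun m => (ha m _ (hgC m)).trans (hSle m))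
  have hPu : ∀ n, H n u + (1/2:ℝ)^n * g n u ≤ h u + δ * (1/4)^n := by
    intro n
    have h1 : H n u + (1/2:ℝ)^n * g n u ≤ S (H n + (1/2:ℝ)^n • g n) :=
      le_ciSup (hHbd n _ (hC0 _ (hgC n))) u
    refine h1.trans ?_
    have h2 : Tendsto (fun k : ℕ => h u + 2 * M * (1/2:ℝ)^(n+k) + δ * (1/4)^n) atTop
        (𝓝 (h u + δ * (1/4)^n)) := by
      refine Tendsto.add_const _ ?_
      refine hlim.comp (tendsto_atTop_mono (fun k => Nat.le_add_left k n) tendsto_id)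
    refine ge_of_tendsto' h2 (fun k => (hP n k _ (hgC _)).trans ?_)
    have := hSle (n+k)
    linarith
  have he : ∀ n, b + ε - 2 * δ + 2 * δ * (1/2)^n ≤ 2^n * (h u - H n u) := by
    intro n
    induction n with
    | zero =>
      simp only [hH0, pow_zero, Pi.zero_apply]
      linarith
    | succ n ih =>
      have h1 := hPu n
      have h2 : H (n+1) u = H n u + (1/2:ℝ)^(n+1) * g n u := by rw [hHs]; rfl
      rw [h2]
      have h3 := mul_le_mul_of_nonneg_left h1 (by positivity : (0:ℝ) ≤ 2^n)
      have e1 : (2:ℝ)^n * (1/2)^n = 1 := by rw [← mul_pow]; norm_num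
      have e2 : (2:ℝ)^n * (1/4)^n = (1/2)^n := by rw [← mul_pow]; norm_num
      have e3 : (2:ℝ)^n * (H n u + (1/2:ℝ)^n * g n u) = 2^n * H n u + g n u := by
        rw [mul_add, ← mul_assoc, e1, one_mul]
      have e4 : (2:ℝ)^n * (h u + δ * (1/4)^n) = 2^n * h u + δ * (1/2)^n := by
        rw [← e2]; ring
      have e5 : (2:ℝ)^(n+1) * (h u - (H n u + (1/2:ℝ)^(n+1) * g n u))
          = 2 * (2^n * h u) - 2 * (2^n * H n u) - g n u := by
        have : (2:ℝ)^(n+1) * (1/2)^(n+1) = 1 := by rw [← mul_pow]; norm_num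
        linear_combination (-g n u) * this
      rw [e5]
      rw [e3, e4] at h3
      rw [pow_succ]
      linarith
  obtain ⟨n, hn⟩ := hb u
  have h1 : h u - H n u ≤ (1/2)^n * b := by
    refine hasSum_le (fun j => ?_) (htail n u) (hgeo n b)
    simp only [F]
    gcongr
    exact hn _ (hanti (by omega) (hgC (j+n)))
  have h2 := mul_le_mul_of_nonneg_left h1 (by positivity : (0:ℝ) ≤ 2^n)
  have e1 : (2:ℝ)^n * (1/2)^n = 1 := by rw [← mul_pow]; norm_num
  rw [← mul_assoc, e1, one_mul] at h2
  have h3 := he n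
  have h4 : 0 < 2 * δ * (1/2)^n := by positivity
  linarith

/-- **Lemma.** Let `Ω` be a completely regular Hausdorff pseudocompact space
and `Φ ⊆ C(Ω)` nonempty with `conv Φ` uniformly bounded and relatively compact in `C(Ω)` for
the topology of pointwise convergence.  Then
`inf_{φ ∈ cl_{τ_p}(conv Φ)} sup_Ω φ = inf_{φ ∈ conv Φ} sup_Ω φ`. -/
theorem lemma_pseudocompact_closure {Ω : Type*} [TopologicalSpace Ω]
    [CompletelyRegularSpace Ω] [T2Space Ω] (hΩ : Pseudocompact Ω)
    (Φ : Set C(Ω, ℝ)) (hΦne : Φ.Nonempty)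
    (hub : ∃ C : ℝ, ∀ g ∈ convexHull ℝ ((fun φ : C(Ω, ℝ) => (φ : Ω → ℝ)) '' Φ),
      ∀ u : Ω, |g u| ≤ C)
    (hcpt : IsCompact
      (closure (convexHull ℝ ((fun φ : C(Ω, ℝ) => (φ : Ω → ℝ)) '' Φ)) : Set (Ω → ℝ)))
    (hcont : ∀ g ∈ (closure (convexHull ℝ ((fun φ : C(Ω, ℝ) => (φ : Ω → ℝ)) '' Φ))
        : Set (Ω → ℝ)), Continuous g) :
    (⨅ g ∈ (closure (convexHull ℝ ((fun φ : C(Ω, ℝ) => (φ : Ω → ℝ)) '' Φ)) : Set (Ω → ℝ)),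
        ⨆ u : Ω, (g u : EReal)) =
      ⨅ g ∈ convexHull ℝ ((fun φ : C(Ω, ℝ) => (φ : Ω → ℝ)) '' Φ),
        ⨆ u : Ω, (g u : EReal) := by
  set K := convexHull ℝ ((fun φ : C(Ω, ℝ) => (φ : Ω → ℝ)) '' Φ) with hK
  apply le_antisymm
  · exact biInf_mono fun g hg => subset_closure hg
  refine le_iInf₂ fun ψ hψ => ?_
  obtain ⟨M, hM⟩ := hub
  have hM' : ∀ g ∈ closure K, ∀ u, |g u| ≤ M := by
    have hcl : IsClosed {g : Ω → ℝ | ∀ u, |g u| ≤ M} := by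
      rw [ofPred_forall]
      exact isClosed_iInter fun u => isClosed_le (by fun_prop) continuous_const
    exact fun g hg => closure_minimal (fun g hg => hM g hg) hcl hg
  obtain ⟨φ, hφK, hφ⟩ := exists_seq_tendsto hΩ K M hM' hcpt hcont ψ hψ
  rw [← EReal.le_of_forall_lt_iff_le]
  intro z hz
  obtain ⟨b, hb1, hb2⟩ := EReal.lt_iff_exists_real_btwn.1 hz
  have hbz : b < z := by exact_mod_cast hb2
  let C : ℕ → Set (Ω → ℝ) := fun n => convexHull ℝ (φ '' Ici n)
  have hCK : C 0 ⊆ K := convexHull_min (by rintro _ ⟨n, _, rfl⟩; exact hφK n)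
    (convex_convexHull _ _)
  obtain ⟨g, hg, hgz⟩ := simons hΩ C
    (fun m n hmn => convexHull_mono (image_mono (Ici_subset_Ici.2 hmn)))
    (fun n => convex_convexHull _ _)
    (fun n => ⟨φ n, subset_convexHull _ _ ⟨n, self_mem_Ici, rfl⟩⟩)
    M (fun g hg => hM g (hCK hg)) (fun g hg => hcont g (subset_closure (hCK hg))) b
    (by
      intro u
      have h1 : ψ u < b := by
        have : (ψ u : EReal) < b := lt_of_le_of_lt (le_iSup (fun u => (ψ u : EReal)) u) hb1
        exact_mod_cast this
      obtain ⟨n, hn⟩ := eventually_atTop.1 ((hφ u).eventually (gt_mem_nhds h1))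
      refine ⟨n, fun g hg => ?_⟩
      have hcv : Convex ℝ {g : Ω → ℝ | g u ≤ b} :=
        convex_halfSpace_le (LinearMap.proj (R := ℝ) (φ := fun _ : Ω => ℝ) u).isLinear b
      exact convexHull_min (by rintro _ ⟨k, hk, rfl⟩; exact (hn k hk).le) hcv hg)
    (z - b) (sub_pos.2 hbz)
  refine iInf₂_le_of_le g (hCK hg) (iSup_le fun u => ?_)
  have := hgz u
  exact_mod_cast (by linarith : g u ≤ z)
end

section
/- Let X and Y be arbitrary nonempty sets and f : X × Y → ℝ a function that is infsup-convex on X and such that for every x ∈ X the function f(x,·) is bounded on Y (so f(x,·) ∈ ℓ^∞(Y)). Then there exists ν ∈ conv̄^{w*}{δ_y : y ∈ Y} (the weak* closed convex hull of the Dirac functionals in ℓ^∞(Y)*) such that inf_{x∈X} sup_{y∈Y} f(x,y) = inf_{x∈X} sup_{μ ∈ conv̄^{w*}{δ_y : y∈Y}} ⟨μ, f(x,·)⟩ = sup_{μ ∈ conv̄^{w*}{δ_y : y∈Y}} inf_{x∈X} ⟨μ, f(x,·)⟩ = inf_{x∈X} ⟨ν, f(x,·)⟩. -/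
open Filter Set
open scoped ENNReal

/-- The Dirac evaluation functional `δ_y` on `ℓ^∞(Y)`, as an element of the weak-* dual. -/
noncomputable def diracLinf {Y : Type*} (y : Y) : WeakDual ℝ (lp (fun _ : Y => ℝ) ∞) :=
  LinearMap.mkContinuous
    { toFun := fun g : lp (fun _ : Y => ℝ) ∞ => g y
      map_add' := fun g h => by simp [lp.coeFn_add]
      map_smul' := fun c g => by simp [lp.coeFn_smul] }
    1
    (fun g => by
      rw [one_mul]
      exact lp.norm_apply_le_norm ENNReal.top_ne_zero g y)

/-- The weak-* closed convex hull of the Dirac functionals. -/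
def diracHull (Y : Type*) : Set (WeakDual ℝ (lp (fun _ : Y => ℝ) ∞)) :=
  closure (convexHull ℝ (Set.range (diracLinf (Y := Y))))

theorem diracLinf_apply' {Y : Type*} (y : Y) (g : lp (fun _ : Y => ℝ) ∞) :
    diracLinf y g = g y := rfl

theorem dirac_mem_hull {Y : Type*} (y : Y) : diracLinf y ∈ diracHull Y :=
  subset_closure (subset_convexHull ℝ _ ⟨y, rfl⟩)

theorem hull_apply_le {Y : Type*} {μ : WeakDual ℝ (lp (fun _ : Y => ℝ) ∞)}
    (hμ : μ ∈ diracHull Y) (g : lp (fun _ : Y => ℝ) ∞) (c : ℝ) (h : ∀ y, g y ≤ c) :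
    μ g ≤ c := by
  have hc : IsClosed {μ : WeakDual ℝ (lp (fun _ : Y => ℝ) ∞) | μ g ≤ c} :=
    isClosed_le (WeakDual.eval_continuous g) continuous_const
  have hconv : Convex ℝ {μ : WeakDual ℝ (lp (fun _ : Y => ℝ) ∞) | μ g ≤ c} :=
    convex_halfSpace_le (f := fun μ : WeakDual ℝ (lp (fun _ : Y => ℝ) ∞) => μ g)
      ⟨fun _ _ => rfl, fun _ _ => rfl⟩ c
  refine closure_minimal (convexHull_min ?_ hconv) hc hμ
  rintro _ ⟨y, rfl⟩
  exact h y

theorem diracHull_compact (Y : Type*) : IsCompact (diracHull Y) := by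
  refine (WeakDual.isCompact_polar ℝ (Metric.closedBall_mem_nhds
    (0 : lp (fun _ : Y => ℝ) ∞) one_pos)).of_isClosed_subset isClosed_closure ?_
  intro μ hμ
  rw [WeakDual.polar_def]
  intro g hg
  have hg1 : ‖g‖ ≤ 1 := by simpa using hg
  have key : ∀ y, |g y| ≤ 1 := fun y =>
    (lp.norm_apply_le_norm ENNReal.top_ne_zero g y).trans hg1
  rw [Real.norm_eq_abs, abs_le]
  constructor
  · have := hull_apply_le hμ (-g) 1 (fun y => by
      have := (abs_le.1 (key y)).1
      simp only [lp.coeFn_neg, Pi.neg_apply]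
      linarith)
    rw [map_neg] at this
    linarith
  · exact hull_apply_le hμ g 1 (fun y => (abs_le.1 (key y)).2)

theorem diracHull_convex (Y : Type*) : Convex ℝ (diracHull Y) :=
  (convex_convexHull ℝ _).closure

/-- Finite minimax step. -/
theorem exists_finite_saddle {Y : Type*} [Nonempty Y] {n : ℕ} (hn : 0 < n)
    (g : Fin n → lp (fun _ : Y => ℝ) ∞) :
    ∃ a ∈ stdSimplex ℝ (Fin n), ∃ b ∈ diracHull Y,
      ∀ i y, ∑ j, a j * g j y ≤ b (g i) := by
  have : Nonempty (Fin n) := ⟨⟨0, hn⟩⟩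
  obtain ⟨a, ha, b, hb, hab⟩ := Sion.exists_isSaddlePointOn
    (X := stdSimplex ℝ (Fin n)) (Y := diracHull Y)
    (f := fun l μ => ∑ j, l j * μ (g j))
    ⟨_, single_mem_stdSimplex ℝ ⟨0, hn⟩⟩ (convex_stdSimplex ℝ _) (isCompact_stdSimplex ℝ _)
    (fun μ _ => by
      refine (Continuous.lowerSemicontinuous ?_).lowerSemicontinuousOn _
      fun_prop)
    (fun μ _ => by
      apply ConvexOn.quasiconvexOn
      refine ⟨convex_stdSimplex ℝ _, fun x _ y _ s t _ _ _ => le_of_eq ?_⟩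
      simp only [Pi.add_apply, Pi.smul_apply, smul_eq_mul, Finset.mul_sum,
        ← Finset.sum_add_distrib]
      exact Finset.sum_congr rfl fun _ _ => by ring)
    (diracHull_convex Y) ⟨_, dirac_mem_hull (Classical.arbitrary Y)⟩ (diracHull_compact Y)
    (fun l _ => by
      refine (Continuous.upperSemicontinuous ?_).upperSemicontinuousOn _
      exact continuous_finset_sum _ fun j _ =>
        continuous_const.mul (WeakDual.eval_continuous (g j)))
    (fun l _ => by
      apply ConcaveOn.quasiconcaveOn
      refine ⟨diracHull_convex Y, fun x _ y _ s t _ _ _ => le_of_eq ?_⟩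
      have e : ∀ j, (s • x + t • y) (g j) = s * x (g j) + t * y (g j) := fun _ => rfl
      simp only [e, smul_eq_mul, Finset.mul_sum, ← Finset.sum_add_distrib]
      exact Finset.sum_congr rfl fun _ _ => by ring)
  refine ⟨a, ha, b, hb, fun i y => ?_⟩
  have := hab _ (single_mem_stdSimplex ℝ i) _ (dirac_mem_hull y)
  simpa [diracLinf_apply', Pi.single_apply] using this

/-- **Lemma.** If `f : X × Y → ℝ` is infsup-convex on `X` and `f(x,·)` is
bounded on `Y` for every `x`, then there is `ν` in the weak-* closed convex hull of the Dirac
functionals on `ℓ^∞(Y)` such that `inf_x sup_y f(x,y)` equals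
`inf_x sup_{μ} ⟨μ, f(x,·)⟩`, `sup_{μ} inf_x ⟨μ, f(x,·)⟩` and `inf_x ⟨ν, f(x,·)⟩`,
where `μ` ranges over that closed convex hull. -/
theorem lemma_infsup_convex_dual {X Y : Type*} [Nonempty X] [Nonempty Y]
    (f : X → Y → ℝ) (hbdd : ∀ x : X, Memℓp (fun y : Y => f x y) ∞)
    (hinfsup : (⨅ x : X, ⨆ y : Y, (f x y : EReal)) =
      ⨅ (n : ℕ) (_ : 0 < n) (xs : Fin n → X) (lam : Fin n → ℝ)
        (_ : lam ∈ stdSimplex ℝ (Fin n)),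
        ⨆ y : Y, ((∑ i, lam i * f (xs i) y : ℝ) : EReal)) :
    ∃ ν ∈ closure (convexHull ℝ (Set.range (diracLinf (Y := Y)))),
      ((⨅ x : X, ⨆ y : Y, (f x y : EReal)) =
        ⨅ x : X, ⨆ μ ∈ closure (convexHull ℝ (Set.range (diracLinf (Y := Y)))),
          ((μ (⟨fun y : Y => f x y, hbdd x⟩ : lp (fun _ : Y => ℝ) ∞) : ℝ) : EReal)) ∧
      ((⨅ x : X, ⨆ y : Y, (f x y : EReal)) =
        ⨆ μ ∈ closure (convexHull ℝ (Set.range (diracLinf (Y := Y)))),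
          ⨅ x : X, ((μ (⟨fun y : Y => f x y, hbdd x⟩ : lp (fun _ : Y => ℝ) ∞) : ℝ) : EReal)) ∧
      ((⨅ x : X, ⨆ y : Y, (f x y : EReal)) =
        ⨅ x : X, ((ν (⟨fun y : Y => f x y, hbdd x⟩ : lp (fun _ : Y => ℝ) ∞) : ℝ) : EReal)) := by
  change ∃ ν ∈ diracHull Y, (_ = ⨅ x : X, ⨆ μ ∈ diracHull Y, _) ∧
    (_ = ⨆ μ ∈ diracHull Y, _) ∧ _
  set v := ⨅ x : X, ⨆ y : Y, (f x y : EReal) with hv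
  let F : X → lp (fun _ : Y => ℝ) ∞ := fun x => ⟨fun y : Y => f x y, hbdd x⟩
  have hub : ∀ x, ∀ μ ∈ diracHull Y, ((μ (F x) : ℝ) : EReal) ≤ ⨆ y : Y, (f x y : EReal) := by
    intro x μ hμ
    refine EReal.le_of_forall_lt_iff_le.1 fun c hc => ?_
    refine EReal.coe_le_coe_iff.2 (hull_apply_le hμ (F x) c fun y => ?_)
    exact EReal.coe_le_coe_iff.1 ((le_iSup (fun y => (f x y : EReal)) y).trans hc.le)
  have hle : ∀ μ ∈ diracHull Y, ⨅ x : X, ((μ (F x) : ℝ) : EReal) ≤ v :=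
    fun μ hμ => iInf_mono fun x => hub x μ hμ
  obtain ⟨ν, hν, hνv⟩ : (diracHull Y ∩ ⋂ x : X,
      {μ : WeakDual ℝ (lp (fun _ : Y => ℝ) ∞) | v ≤ ((μ (F x) : ℝ) : EReal)}).Nonempty := by
    refine (diracHull_compact Y).inter_iInter_nonempty _ (fun x => ?_) (fun u => ?_)
    · exact isClosed_le continuous_const
        (continuous_coe_real_ereal.comp (WeakDual.eval_continuous (F x)))
    · rcases u.eq_empty_or_nonempty with rfl | hu
      · exact ⟨_, dirac_mem_hull (Classical.arbitrary Y), by simp⟩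
      obtain ⟨a, ha, b, hb, hab⟩ := exists_finite_saddle hu.card_pos
        (fun i => F (u.equivFin.symm i))
      refine ⟨b, hb, ?_⟩
      simp only [Set.mem_iInter, Set.mem_setOf_eq]
      intro x hx
      rw [hinfsup]
      refine (iInf₂_le_of_le u.card hu.card_pos <|
        iInf_le_of_le (fun i => ((u.equivFin.symm i : u) : X)) <| iInf₂_le_of_le a ha le_rfl).trans
        (iSup_le fun y => EReal.coe_le_coe_iff.2 ?_)
      have := hab (u.equivFin ⟨x, hx⟩) y
      simpa [F] using this
  simp only [Set.mem_iInter, Set.mem_setOf_eq] at hνv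
  refine ⟨ν, hν, ?_, ?_, ?_⟩
  · refine le_antisymm (iInf_mono fun x => iSup_le fun y => ?_)
      (iInf_mono fun x => iSup₂_le fun μ hμ => hub x μ hμ)
    exact le_iSup₂_of_le (f := fun (μ : WeakDual ℝ (lp (fun _ : Y => ℝ) ∞))
      (_ : μ ∈ diracHull Y) => ((μ (F x) : ℝ) : EReal)) (diracLinf y) (dirac_mem_hull y) le_rfl
  · exact le_antisymm (le_iSup₂_of_le (f := fun (μ : WeakDual ℝ (lp (fun _ : Y => ℝ) ∞))
      (_ : μ ∈ diracHull Y) => ⨅ x : X, ((μ (F x) : ℝ) : EReal)) ν hν (le_iInf hνv))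
      (iSup₂_le hle)
  · exact le_antisymm (le_iInf hνv) (hle ν hν)
end

section
/- Let X be an arbitrary nonempty set and Y a completely regular Hausdorff pseudocompact topological space. Let H, L : X × Y → ℝ be two functions such that H is bounded on X × Y, for every y ∈ Y the function L(·,y) is bounded on X, and: (i) H is infsup-convex on X, each function H(x,·) is continuous on Y, and the convex hull conv({H(x,·) : x ∈ X}) is relatively compact in C(Y) for the topology of pointwise convergence on Y; (ii) L is supinf-concave on Y; (iii) H ≤ L on X × Y. Then inf_{x∈X} sup_{y∈Y} H(x,y) ≤ sup_{y∈Y} inf_{x∈X} L(x,y). -/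
open Filter Set

theorem exists_seq_of_local {α : Type*} [Nonempty α] (P : ℕ → (ℕ → α) → α → Prop)
    (hloc : ∀ n u v a, (∀ k < n, u k = v k) → P n u a → P n v a)
    (hex : ∀ n u, ∃ a, P n u a) : ∃ u : ℕ → α, ∀ n, P n u (u n) := by
  classical
  choose next hnext using hex
  let a0 : α := Classical.arbitrary α
  let F : ∀ n : ℕ, (∀ k, k < n → α) → α :=
    fun n ih => next n (fun k => if h : k < n then ih k h else a0)
  let u : ℕ → α := fun n => WellFounded.fix (measure id : WellFoundedRelation ℕ).wf F n
  have hu : ∀ n, u n = next n (fun k => if k < n then u k else a0) := by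
    intro n
    change WellFounded.fix _ F n = _
    rw [WellFounded.fix_eq]
    simp only [F, u, dite_eq_ite]
  refine ⟨u, fun n => ?_⟩
  have h1 := hnext n (fun k => if k < n then u k else a0)
  rw [← hu n] at h1
  exact hloc n _ _ _ (fun k hk => by simp [hk]) h1

theorem exists_pos_lower {Y : Type*} [TopologicalSpace Y] (hY : Pseudocompact Y)
    (h : Y → ℝ) (hc : Continuous h) (hpos : ∀ y, 0 < h y) : ∃ ε > 0, ∀ y, ε ≤ h y := by
  obtain ⟨B, hB⟩ := hY ⟨fun y => (h y)⁻¹, hc.inv₀ (fun y => (hpos y).ne')⟩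
  refine ⟨(|B| + 1)⁻¹, by positivity, fun y => ?_⟩
  have h1 : (h y)⁻¹ ≤ |B| + 1 := by
    have h2 := hB y
    have h3 := le_abs_self ((h y)⁻¹)
    have h4 := le_abs_self B
    simp only [ContinuousMap.coe_mk] at h2
    linarith
  exact inv_le_of_inv_le₀ (hpos y) h1

theorem exists_max_of_pseudocompact {Y : Type*} [TopologicalSpace Y] [Nonempty Y]
    (hY : Pseudocompact Y) (f : Y → ℝ) (hf : Continuous f) : ∃ y, ∀ z, f z ≤ f y := by
  by_contra hno
  push Not at hno
  obtain ⟨B, hB⟩ := hY ⟨f, hf⟩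
  have hbdd : BddAbove (Set.range f) := by
    refine ⟨B, ?_⟩
    rintro _ ⟨y, rfl⟩
    exact (le_abs_self _).trans (hB y)
  have hlt : ∀ y, 0 < (⨆ z, f z) - f y := by
    intro y
    obtain ⟨z, hz⟩ := hno y
    have := le_ciSup hbdd z
    linarith
  obtain ⟨ε, hε, h⟩ := exists_pos_lower hY (fun y => (⨆ z, f z) - f y) (by fun_prop) hlt
  have : (⨆ z, f z) ≤ (⨆ z, f z) - ε := ciSup_le (fun y => by have := h y; linarith)
  linarith

theorem exists_finset_dense {Y : Type*} {k : ℕ} (v : Fin k → Y → ℝ) (M : ℝ)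
    (hM : ∀ i y, |v i y| ≤ M) (ε : ℝ) (hε : 0 < ε) :
    ∃ D : Finset Y, ∀ y, ∃ d ∈ D, ∀ i, |v i d - v i y| < ε := by
  classical
  let Φ : Y → Fin k → ℝ := fun y i => v i y
  have htb : TotallyBounded (Set.range Φ) := by
    refine TotallyBounded.subset ?_ (isCompact_Icc (a := fun _ : Fin k => -M)
      (b := fun _ => M)).totallyBounded
    rintro _ ⟨y, rfl⟩
    exact ⟨fun i => (abs_le.1 (hM i y)).1, fun i => (abs_le.1 (hM i y)).2⟩
  obtain ⟨t, hts, htf, hcov⟩ := Metric.finite_approx_of_totallyBounded htb ε hε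
  have h1 : ∀ p : t, ∃ y, Φ y = p := fun p => hts p.2
  choose w hw using h1
  haveI := htf.fintype
  refine ⟨Finset.univ.image w, fun y => ?_⟩
  have h2 := hcov ⟨y, rfl⟩
  simp only [Set.mem_iUnion, Metric.mem_ball] at h2
  obtain ⟨p, hp, hd⟩ := h2
  refine ⟨w ⟨p, hp⟩, by simp, fun i => ?_⟩
  have h3 := (dist_pi_lt_iff hε).1 hd i
  have h4 : p i = v i (w ⟨p, hp⟩) := (congrFun (hw ⟨p, hp⟩) i).symm
  rw [dist_comm, h4, Real.dist_eq] at h3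
  exact h3

/-- Eberlein-type step: the sequence is eventually below any level above `c`. -/
theorem eventually_lt_of_dense {Y : Type*} [TopologicalSpace Y] (hY : Pseudocompact Y)
    (A : Set (Y → ℝ)) (hcpt : IsCompact (closure A)) (hcont : ∀ g ∈ closure A, Continuous g)
    (u : ℕ → Y → ℝ) (hu : ∀ n, u n ∈ A) (c : ℝ) (D : ℕ → Finset Y)
    (hD : ∀ k y, ∃ d ∈ D k, ∀ i < k, |u i d - u i y| < 1 / ((k : ℝ) + 1))
    (hle : ∀ n, ∀ k ≤ n, ∀ d ∈ D k, u n d ≤ c) (y : Y) (c' : ℝ) (hc' : c < c') :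
    ∀ᶠ n in atTop, u n y < c' := by
  by_contra hno
  have hfr : ∃ᶠ n in atTop, c' ≤ u n y := by
    simpa [Filter.Frequently] using hno
  haveI : NeBot (atTop ⊓ 𝓟 {n | c' ≤ u n y}) := Filter.frequently_mem_iff_neBot.1 hfr
  let F : Ultrafilter ℕ := Ultrafilter.of (atTop ⊓ 𝓟 {n | c' ≤ u n y})
  have hF : (F : Filter ℕ) ≤ atTop ⊓ 𝓟 {n | c' ≤ u n y} := Ultrafilter.of_le _
  have hF1 : (F : Filter ℕ) ≤ atTop := hF.trans inf_le_left
  have hF2 : ∀ᶠ n in (F : Filter ℕ), c' ≤ u n y := by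
    have := hF.trans inf_le_right
    exact Filter.le_principal_iff.1 this
  obtain ⟨g, hg, hlim⟩ := hcpt.ultrafilter_le_nhds (F.map u) (by
    rw [Filter.le_principal_iff]
    have hall : ∀ᶠ n in (F : Filter ℕ), u n ∈ closure A :=
      Filter.Eventually.of_forall (fun n => subset_closure (hu n))
    exact hall)
  have hlim' : ∀ z, Tendsto (fun n => u n z) F (nhds (g z)) := by
    intro z
    have h1 : Tendsto u F (nhds g) := hlim
    exact tendsto_pi_nhds.1 h1 z
  have hgy : c' ≤ g y := ge_of_tendsto (hlim' y) hF2
  have hgD : ∀ k, ∀ d ∈ D k, g d ≤ c := by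
    intro k d hd
    refine le_of_tendsto (hlim' d) ?_
    exact Filter.Eventually.filter_mono hF1
      ((eventually_ge_atTop k).mono (fun n hn => hle n k hn d hd))
  have hgc : Continuous g := hcont g hg
  have huc : ∀ n, Continuous (u n) := fun n => hcont _ (subset_closure (hu n))
  let t : ℕ → Y → ℝ := fun i z => (1 / 2 : ℝ) ^ i * min 1 |u i z - u i y|
  have ht0 : ∀ i z, 0 ≤ t i z := fun i z => by positivity
  have ht1 : ∀ i z, ‖t i z‖ ≤ (1 / 2 : ℝ) ^ i := by
    intro i z
    rw [Real.norm_of_nonneg (ht0 i z)]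
    exact mul_le_of_le_one_right (by positivity) (min_le_left _ _)
  have hsum : Summable (fun i : ℕ => (1 / 2 : ℝ) ^ i) := summable_geometric_two
  have htc : Continuous (fun z => ∑' i, t i z) := by
    refine continuous_tsum (fun i => ?_) hsum ht1
    have := huc i
    fun_prop
  have hts : ∀ z, Summable (fun i => t i z) := fun z => Summable.of_norm_bounded hsum (ht1 · z)
  obtain ⟨ε, hε, hlow⟩ := exists_pos_lower hY (fun z => (∑' i, t i z) + max (g z - c) 0)
    (by fun_prop) (by
      intro z
      have h1 : 0 ≤ ∑' i, t i z := tsum_nonneg (ht0 · z)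
      have h2 : 0 ≤ max (g z - c) 0 := le_max_right _ _
      by_contra hcon
      have h3 : ∑' i, t i z = 0 := by linarith
      have h4 : max (g z - c) 0 = 0 := by linarith
      have h5 : g z ≤ c := by
        have := le_max_left (g z - c) 0
        linarith
      have h6 : ∀ i, u i z = u i y := by
        intro i
        have h7 : t i z ≤ 0 := h3 ▸ (hts z).le_tsum i (fun j _ => ht0 j z)
        have h8 : min 1 |u i z - u i y| ≤ 0 := by
          by_contra h
          push Not at h
          have : 0 < t i z := by positivity
          linarith
        have h9 : |u i z - u i y| ≤ 0 := by
          rcases min_le_iff.1 h8 with h | h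
          · linarith
          · exact h
        have := abs_nonpos_iff.1 h9
        linarith
      have h10 : g z = g y := by
        refine tendsto_nhds_unique (hlim' z) ?_
        simpa [h6] using hlim' y
      linarith)
  choose d hd hdd using fun k => hD k y
  have hlim0 : Tendsto (fun k => ∑' i, t i (d k)) atTop (nhds (∑' _ : ℕ, (0 : ℝ))) := by
    refine tendsto_tsum_of_dominated_convergence hsum (fun i => ?_)
      (Filter.Eventually.of_forall (fun k i => ht1 i (d k)))
    refine squeeze_zero' (Filter.Eventually.of_forall (fun k => ht0 i (d k))) ?_
      tendsto_one_div_add_atTop_nhds_zero_nat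
    filter_upwards [eventually_gt_atTop i] with k hk
    have h1 := hdd k i hk
    have h2 : (1 / 2 : ℝ) ^ i ≤ 1 := pow_le_one₀ (by norm_num) (by norm_num)
    calc t i (d k) ≤ 1 * |u i (d k) - u i y| :=
          mul_le_mul h2 (min_le_right _ _) (by positivity) (by norm_num)
      _ ≤ _ := by linarith
  rw [tsum_zero] at hlim0
  have : ε ≤ 0 := by
    refine ge_of_tendsto' hlim0 (fun k => ?_)
    have h1 := hlow (d k)
    have h2 : max (g (d k) - c) 0 = 0 := max_eq_right (by have := hgD k _ (hd k); linarith)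
    simp only [h2] at h1
    linarith
  linarith

/-- `T u n b = ∑_{k<n} 2^{-k-1} u k + 2^{-n} b`. -/
noncomputable def TT {Y : Type*} (u : ℕ → Y → ℝ) (n : ℕ) (b : Y → ℝ) : Y → ℝ :=
  fun y => (∑ k ∈ Finset.range n, (1 / 2 : ℝ) ^ (k + 1) * u k y) + (1 / 2 : ℝ) ^ n * b y

theorem TT_succ {Y : Type*} (u : ℕ → Y → ℝ) (n : ℕ) (b : Y → ℝ) :
    TT u (n + 1) b = TT u n ((1 / 2 : ℝ) • u n + (1 / 2 : ℝ) • b) := by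
  funext y
  simp only [TT, Finset.sum_range_succ, Pi.add_apply, Pi.smul_apply, smul_eq_mul]
  ring

theorem TT_reduce {Y : Type*} (u : ℕ → Y → ℝ) (n : ℕ) (C : Set (Y → ℝ)) (hC : Convex ℝ C)
    (hu : ∀ k ≥ n, u k ∈ C) (j : ℕ) :
    ∀ b ∈ C, ∃ b' ∈ C, TT u (n + j) b = TT u n b' := by
  induction j with
  | zero => exact fun b hb => ⟨b, hb, rfl⟩
  | succ j ih =>
    intro b hb
    rw [← add_assoc, TT_succ]
    exact ih _ (hC (hu _ (by omega)) hb (by norm_num) (by norm_num) (by norm_num))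

theorem TT_mem {Y : Type*} (u : ℕ → Y → ℝ) (A : Set (Y → ℝ)) (hA : Convex ℝ A)
    (hu : ∀ k, u k ∈ A) (n : ℕ) (b : Y → ℝ) (hb : b ∈ A) : TT u n b ∈ A := by
  obtain ⟨b', hb', h⟩ := TT_reduce u 0 A hA (fun k _ => hu k) n b hb
  rw [zero_add] at h
  rw [h]
  have : TT u 0 b' = b' := by funext y; simp [TT]
  rwa [this]

theorem core_lemma {Y : Type*} [TopologicalSpace Y] [Nonempty Y] (hY : Pseudocompact Y)
    (A : Set (Y → ℝ)) (hA : Convex ℝ A)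
    (hcpt : IsCompact (closure A)) (hcont : ∀ g ∈ closure A, Continuous g)
    (M : ℝ) (hM : ∀ f ∈ A, ∀ y, |f y| ≤ M) (c m : ℝ) (hm : 0 < m)
    (hfin : ∀ D : Finset Y, ∃ f ∈ A, ∀ d ∈ D, f d ≤ c)
    (hbig : ∀ f ∈ A, ∃ y, c + m ≤ f y) : False := by
  classical
  have hM0 : 0 ≤ M := by
    obtain ⟨f, hf, -⟩ := hfin ∅
    exact (abs_nonneg _).trans (hM f hf (Classical.arbitrary Y))
  have hDex : ∀ (k : ℕ) (v : Fin k → A), ∃ D : Finset Y, ∀ y, ∃ d ∈ D, ∀ i,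
      |(v i : Y → ℝ) d - (v i : Y → ℝ) y| < 1 / ((k : ℝ) + 1) := fun k v =>
    exists_finset_dense (fun i => (v i : Y → ℝ)) M (fun i => hM _ (v i).2) _ (by positivity)
  choose D hD using hDex
  haveI : Nonempty A := by
    obtain ⟨f, hf, -⟩ := hfin ∅
    exact ⟨⟨f, hf⟩⟩
  let DD : ℕ → (ℕ → A) → Finset Y := fun k u => D k (fun i => u i)
  let C : ℕ → (ℕ → A) → Set (Y → ℝ) := fun n u =>
    {b | b ∈ A ∧ ∀ k ≤ n, ∀ d ∈ DD k u, b d ≤ c}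
  let P : ℕ → (ℕ → A) → A → Prop := fun n u a => (a : Y → ℝ) ∈ C n u ∧
    ∀ b ∈ C n u, ∀ q : ℝ, (∀ z, TT (fun k => (u k : Y → ℝ)) n b z ≤ q) →
      ∀ z, TT (fun k => (u k : Y → ℝ)) n a z ≤ q + m / 6 * (1 / 4) ^ n
  obtain ⟨u, hu⟩ := exists_seq_of_local P (by
    intro n u v a huv h
    have h1 : ∀ k ≤ n, DD k u = DD k v := by
      intro k hk
      have : (fun i : Fin k => u i) = (fun i : Fin k => v i) := by
        funext i
        exact huv i (by omega)
      simp only [DD, this]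
    have h2 : C n u = C n v := by
      ext b
      simp only [C, Set.mem_setOf_eq]
      refine and_congr_right (fun _ => forall₂_congr (fun k hk => ?_))
      rw [h1 k hk]
    have h3 : ∀ b : Y → ℝ, TT (fun k => (u k : Y → ℝ)) n b
        = TT (fun k => (v k : Y → ℝ)) n b := by
      intro b
      funext y
      simp only [TT]
      congr 1
      refine Finset.sum_congr rfl (fun k hk => ?_)
      rw [huv k (Finset.mem_range.1 hk)]
    simp only [P] at h ⊢
    rw [← h2]
    simp only [← h3]
    exact h) (by
    intro n u
    let y0 : Y := Classical.arbitrary Y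
    let Q : Set ℝ := {q | ∃ b ∈ C n u, ∀ z, TT (fun k => (u k : Y → ℝ)) n b z ≤ q}
    have hTA : ∀ b ∈ C n u, TT (fun k => (u k : Y → ℝ)) n b ∈ A := fun b hb =>
      TT_mem _ A hA (fun k => (u k).2) n b hb.1
    have hQb : BddBelow Q := by
      refine ⟨-M, ?_⟩
      rintro q ⟨b, hb, hq⟩
      exact ((abs_le.1 (hM _ (hTA b hb) y0)).1).trans (hq y0)
    have hQne : Q.Nonempty := by
      obtain ⟨f, hf, hfd⟩ := hfin ((Finset.range (n + 1)).biUnion (fun k => DD k u))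
      have hfC : f ∈ C n u := ⟨hf, fun k hk d hd => hfd d (by
        rw [Finset.mem_biUnion]
        exact ⟨k, Finset.mem_range.2 (by omega), hd⟩)⟩
      exact ⟨M, f, hfC, fun z => (abs_le.1 (hM _ (hTA f hfC) z)).2⟩
    obtain ⟨q, ⟨a, ha, haq⟩, hq⟩ := Real.lt_sInf_add_pos hQne
      (show 0 < m / 6 * (1 / 4 : ℝ) ^ n by positivity)
    refine ⟨⟨a, ha.1⟩, ha, fun b hb q' hq' z => ?_⟩
    have h1 : sInf Q ≤ q' := csInf_le hQb ⟨b, hb, hq'⟩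
    have h2 := haq z
    simp only
    linarith)
  let w : ℕ → Y → ℝ := fun k => (u k : Y → ℝ)
  have hwA : ∀ k, w k ∈ A := fun k => (u k).2
  have hwc : ∀ k, Continuous (w k) := fun k => hcont _ (subset_closure (hwA k))
  have hev := eventually_lt_of_dense hY A hcpt hcont w hwA c (fun k => DD k u)
    (by
      intro k y
      obtain ⟨d, hd, h⟩ := hD k (fun i => u i) y
      exact ⟨d, hd, fun i hi => h ⟨i, hi⟩⟩)
    (fun n k hk d hd => (hu n).1.2 k hk d hd)
  -- the sum
  have hgs : Summable (fun k : ℕ => (1 / 2 : ℝ) ^ (k + 1) * M) :=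
    ((summable_nat_add_iff 1).2 summable_geometric_two).mul_right M
  have hterm : ∀ k y, ‖(1 / 2 : ℝ) ^ (k + 1) * w k y‖ ≤ (1 / 2 : ℝ) ^ (k + 1) * M := by
    intro k y
    rw [norm_mul, Real.norm_of_nonneg (by positivity)]
    exact mul_le_mul_of_nonneg_left (hM _ (hwA k) y) (by positivity)
  let S : Y → ℝ := fun y => ∑' k, (1 / 2 : ℝ) ^ (k + 1) * w k y
  have hSs : ∀ y, Summable (fun k : ℕ => (1 / 2 : ℝ) ^ (k + 1) * w k y) := fun y =>
    Summable.of_norm_bounded hgs (hterm · y)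
  have hSc : Continuous S := continuous_tsum (fun k => by have := hwc k; fun_prop) hgs hterm
  obtain ⟨y, hy⟩ := exists_max_of_pseudocompact hY S hSc
  -- tail upper bound
  have hgeo : ∀ n : ℕ, ∀ q : ℝ, HasSum (fun k : ℕ => (1 / 2 : ℝ) ^ (k + n + 1) * q)
      ((1 / 2 : ℝ) ^ n * q) := by
    intro n q
    have h1 := (hasSum_geometric_two.mul_left ((1 / 2 : ℝ) ^ (n + 1))).mul_right q
    have h2 : (fun k : ℕ => (1 / 2 : ℝ) ^ (k + n + 1) * q) =
        fun i : ℕ => (1 / 2 : ℝ) ^ (n + 1) * (1 / 2) ^ i * q := by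
      funext k; ring
    have h3 : (1 / 2 : ℝ) ^ n * q = (1 / 2 : ℝ) ^ (n + 1) * 2 * q := by ring
    rw [h2, h3]
    exact h1
  have htail : ∀ n z q, (∀ k ≥ n, w k z ≤ q) →
      S z - ∑ k ∈ Finset.range n, (1 / 2 : ℝ) ^ (k + 1) * w k z ≤ (1 / 2 : ℝ) ^ n * q := by
    intro n z q hq
    have h1 := (hSs z).sum_add_tsum_nat_add n
    have h2 : ∑' k, (1 / 2 : ℝ) ^ (k + n + 1) * w (k + n) z ≤ (1 / 2 : ℝ) ^ n * q := by
      rw [← (hgeo n q).tsum_eq]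
      refine Summable.tsum_le_tsum (fun k => ?_) ((summable_nat_add_iff n).2 (hSs z))
        (hgeo n q).summable
      exact mul_le_mul_of_nonneg_left (hq _ (by omega)) (by positivity)
    simp only [S]
    linarith
  have htail' : ∀ n z q, (∀ k ≥ n, q ≤ w k z) →
      (1 / 2 : ℝ) ^ n * q ≤ S z - ∑ k ∈ Finset.range n, (1 / 2 : ℝ) ^ (k + 1) * w k z := by
    intro n z q hq
    have h1 := (hSs z).sum_add_tsum_nat_add n
    have h2 : (1 / 2 : ℝ) ^ n * q ≤ ∑' k, (1 / 2 : ℝ) ^ (k + n + 1) * w (k + n) z := by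
      rw [← (hgeo n q).tsum_eq]
      refine Summable.tsum_le_tsum (fun k => ?_) (hgeo n q).summable
        ((summable_nat_add_iff n).2 (hSs z))
      exact mul_le_mul_of_nonneg_left (hq _ (by omega)) (by positivity)
    simp only [S]
    linarith
  have hTS : ∀ N z, TT w N (w N) z ≤ S y + 2 * M * (1 / 2 : ℝ) ^ N := by
    intro N z
    have h1 := htail' N z (-M) (fun k _ => (abs_le.1 (hM _ (hwA k) z)).1)
    have h2 := (abs_le.1 (hM _ (hwA N) z)).2
    have h3 : (1 / 2 : ℝ) ^ N * w N z ≤ (1 / 2 : ℝ) ^ N * M :=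
      mul_le_mul_of_nonneg_left h2 (by positivity)
    have h4 := hy z
    simp only [TT]
    linarith
  have hlimr : ∀ b : ℝ, Tendsto (fun N : ℕ => b + 2 * M * (1 / 2 : ℝ) ^ N) atTop (nhds b) := by
    intro b
    have := ((tendsto_pow_atTop_nhds_zero_of_lt_one (r := (1 / 2 : ℝ)) (by norm_num)
      (by norm_num)).const_mul (2 * M)).const_add b
    simpa using this
  have hSbig : c + m ≤ S y := by
    refine ge_of_tendsto' (hlimr (S y)) (fun N => ?_)
    obtain ⟨z, hz⟩ := hbig _ (TT_mem w A hA hwA N (w N) (hwA N))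
    exact hz.trans (hTS N z)
  have hCconv : ∀ n, Convex ℝ (C n u) := by
    intro n a ha b hb s t hs ht hst
    refine ⟨hA ha.1 hb.1 hs ht hst, fun k hk d hd => ?_⟩
    have h1 := ha.2 k hk d hd
    have h2 := hb.2 k hk d hd
    simp only [Pi.add_apply, Pi.smul_apply, smul_eq_mul]
    have : c = s * c + t * c := by rw [← add_mul, hst, one_mul]
    rw [this]
    gcongr
  have hstar : ∀ n z, TT w n (w n) z ≤ S y + m / 6 * (1 / 4) ^ n := by
    intro n z
    have h1 : ∀ j, TT w n (w n) z ≤ (S y + m / 6 * (1 / 4) ^ n) + 2 * M * (1 / 2 : ℝ) ^ j := by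
      intro j
      obtain ⟨b', hb', hT⟩ := TT_reduce w n (C n u) (hCconv n)
        (fun k hk => ⟨hwA k, fun i hi d hd => (hu k).1.2 i (hi.trans hk) d hd⟩) j (w (n + j))
        ⟨hwA _, fun i hi d hd => (hu (n + j)).1.2 i (by omega) d hd⟩
      have h2 := (hu n).2 b' hb' (S y + 2 * M * (1 / 2 : ℝ) ^ (n + j)) (by
        intro z
        have := hTS (n + j) z
        rw [hT] at this
        exact this) z
      have h3 : (1 / 2 : ℝ) ^ (n + j) ≤ (1 / 2 : ℝ) ^ j :=
        pow_le_pow_of_le_one (by norm_num) (by norm_num) (by omega)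
      have h4 : 2 * M * (1 / 2 : ℝ) ^ (n + j) ≤ 2 * M * (1 / 2 : ℝ) ^ j :=
        mul_le_mul_of_nonneg_left h3 (by linarith)
      have h5 : TT w n (w n) z ≤ S y + 2 * M * (1 / 2 : ℝ) ^ (n + j) + m / 6 * (1 / 4) ^ n := h2
      linarith
    exact ge_of_tendsto' (hlimr _) h1
  have hind : ∀ n z, ∑ k ∈ Finset.range n, (1 / 2 : ℝ) ^ (k + 1) * w k z ≤
      S y - (1 / 2 : ℝ) ^ n * (S y - m / 3 * (1 - (1 / 2 : ℝ) ^ n)) := by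
    intro n z
    induction n with
    | zero => simp
    | succ n ih =>
      have h1 := hstar n z
      simp only [TT] at h1
      rw [Finset.sum_range_succ]
      have h4 : (1 / 4 : ℝ) ^ n = (1 / 2 : ℝ) ^ n * (1 / 2 : ℝ) ^ n := by
        rw [← mul_pow]; norm_num
      rw [h4] at h1
      rw [pow_succ]
      nlinarith [h1, ih]
  obtain ⟨n, hn⟩ := eventually_atTop.1 (hev y (c + m / 3) (by linarith))
  have h1 := htail n y (c + m / 3) (fun k hk => (hn k hk).le)
  have h2 := hind n y
  have hr : (0 : ℝ) < (1 / 2 : ℝ) ^ n := by positivity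
  have h3 : (1 / 2 : ℝ) ^ n * (S y - m / 3 * (1 - (1 / 2 : ℝ) ^ n)) ≤
      (1 / 2 : ℝ) ^ n * (c + m / 3) := by linarith
  have h4 := le_of_mul_le_mul_left h3 hr
  nlinarith

/-- Finite-dimensional minimax by separation. -/
theorem finite_minimax {n : ℕ} (B : Set (Fin n → ℝ)) (hB : Convex ℝ B) (hne : B.Nonempty)
    (c : ℝ) (h : ∀ v ∈ B, ∃ i, c ≤ v i) :
    0 < n ∧ ∃ lam ∈ stdSimplex ℝ (Fin n), ∀ v ∈ B, c ≤ ∑ i, lam i * v i := by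
  classical
  have hn : 0 < n := by
    obtain ⟨v, hv⟩ := hne
    obtain ⟨i, -⟩ := h v hv
    exact i.pos
  refine ⟨hn, ?_⟩
  let U : Set (Fin n → ℝ) := Set.univ.pi (fun _ => Set.Iio c)
  have hUo : IsOpen U := isOpen_set_pi Set.finite_univ (fun _ _ => isOpen_Iio)
  have hUc : Convex ℝ U := convex_pi (fun _ _ => convex_Iio c)
  have hdisj : Disjoint U B := by
    rw [Set.disjoint_left]
    intro v hvU hvB
    obtain ⟨i, hi⟩ := h v hvB
    have := hvU i (Set.mem_univ i)
    simp only [Set.mem_Iio] at this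
    linarith
  obtain ⟨φ, r, hφU, hφB⟩ := geometric_hahn_banach_open hUc hUo hB hdisj
  let μ : Fin n → ℝ := fun i => φ (Pi.single i 1)
  have hφ : ∀ v, φ v = ∑ i, μ i * v i := by
    intro v
    conv_lhs => rw [pi_eq_sum_univ' v]
    simp [μ, mul_comm]
  have hμ : ∀ i, 0 ≤ μ i := by
    intro i
    by_contra hneg
    push Not at hneg
    -- go to minus infinity
    let b : Fin n → ℝ := fun _ => c - 1
    obtain ⟨K, hK⟩ : ∃ K : ℝ, 0 ≤ K ∧ r ≤ φ b + K * (-μ i) := by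
      refine ⟨|r - φ b| / (-μ i), div_nonneg (abs_nonneg _) (by linarith), ?_⟩
      rw [div_mul_cancel₀ _ (by linarith)]
      linarith [le_abs_self (r - φ b)]
    have h1 : b - K • Pi.single i (1 : ℝ) ∈ U := by
      intro j _
      by_cases hj : j = i
      · subst hj
        simp [b]; linarith
      · simp [b, hj]
    have h2 := hφU _ h1
    rw [map_sub, map_smul, smul_eq_mul] at h2
    change φ b - K * μ i < r at h2
    linarith
  have hsumnn : 0 ≤ ∑ i, μ i := Finset.sum_nonneg (fun i _ => hμ i)
  have hpos : 0 < ∑ i, μ i := by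
    rcases hsumnn.lt_or_eq with h1 | h1
    · exact h1
    · exfalso
      have h2 : ∀ i, μ i = 0 := by
        intro i
        exact (Finset.sum_eq_zero_iff_of_nonneg (fun i _ => hμ i)).1 h1.symm i (Finset.mem_univ i)
      have h3 : ∀ v, φ v = 0 := by intro v; rw [hφ]; simp [h2]
      obtain ⟨v, hv⟩ := hne
      have h4 := hφB v hv
      have h5 := hφU (fun _ => c - 1) (fun i _ => by simp)
      rw [h3] at h4 h5
      linarith
  have hcr : c * ∑ i, μ i ≤ r := by
    refine le_of_forall_pos_le_add (fun ε hε => ?_)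
    have h5 := hφU (fun _ => c - ε / ∑ i, μ i) (fun i _ => by
      simp only [Set.mem_Iio]
      have : 0 < ε / ∑ i, μ i := by positivity
      linarith)
    rw [hφ, ← Finset.sum_mul] at h5
    have h6 : (∑ i, μ i) * (c - ε / ∑ i, μ i) = c * ∑ i, μ i - ε := by field_simp
    linarith
  refine ⟨fun i => μ i / ∑ j, μ j, ⟨fun i => div_nonneg (hμ i) hsumnn, ?_⟩, fun v hv => ?_⟩
  · rw [← Finset.sum_div, div_self hpos.ne']
  · have h1 := hφB v hv
    rw [hφ] at h1
    have h2 : ∑ i, μ i / (∑ j, μ j) * v i = (∑ i, μ i * v i) / ∑ j, μ j := by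
      rw [Finset.sum_div]
      exact Finset.sum_congr rfl (fun i _ => by ring)
    rw [h2, le_div_iff₀ hpos]
    linarith

/-- **minimax theorem in pseudocompact spaces.** Let `X` be a nonempty set,
`Y` a completely regular Hausdorff pseudocompact space, `H, L : X × Y → ℝ` with `H` bounded
on `X × Y`, `L(·,y)` bounded on `X`, `H` infsup-convex on `X` with `H(x,·)` continuous and
`conv {H(x,·) : x ∈ X}` relatively compact in `C(Y)` for the pointwise topology, `L`
supinf-concave on `Y`, and `H ≤ L`.  Then
`inf_x sup_y H(x,y) ≤ sup_y inf_x L(x,y)`. -/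
theorem minimax_pseudocompact {X : Type*} [Nonempty X]
    {Y : Type*} [TopologicalSpace Y] [CompletelyRegularSpace Y] [T2Space Y]
    (hY : Pseudocompact Y)
    (H L : X → Y → ℝ)
    (hHbdd : ∃ C : ℝ, ∀ (x : X) (y : Y), |H x y| ≤ C)
    (hLbdd : ∀ y : Y, ∃ C : ℝ, ∀ x : X, |L x y| ≤ C)
    (hHinfsup : (⨅ x : X, ⨆ y : Y, (H x y : EReal)) =
      ⨅ (n : ℕ) (_ : 0 < n) (xs : Fin n → X) (lam : Fin n → ℝ)
        (_ : lam ∈ stdSimplex ℝ (Fin n)),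
        ⨆ y : Y, ((∑ i, lam i * H (xs i) y : ℝ) : EReal))
    (hHcont : ∀ x : X, Continuous (H x))
    (hcpt : IsCompact
      (closure (convexHull ℝ (Set.range fun x : X => H x)) : Set (Y → ℝ)))
    (hcl_cont : ∀ g ∈ (closure (convexHull ℝ (Set.range fun x : X => H x))
        : Set (Y → ℝ)), Continuous g)
    (hconc : (⨆ y : Y, ⨅ x : X, (L x y : EReal)) =
      ⨆ (n : ℕ) (_ : 0 < n) (ys : Fin n → Y) (lam : Fin n → ℝ)
        (_ : lam ∈ stdSimplex ℝ (Fin n)),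
        ⨅ x : X, ((∑ i, lam i * L x (ys i) : ℝ) : EReal))
    (hHL : ∀ (x : X) (y : Y), H x y ≤ L x y) :
    (⨅ x : X, ⨆ y : Y, (H x y : EReal)) ≤ ⨆ y : Y, ⨅ x : X, (L x y : EReal) := by
  classical
  rcases isEmpty_or_nonempty Y with hYe | hYne
  · obtain ⟨x⟩ := ‹Nonempty X›
    refine (iInf_le _ x).trans ?_
    simp
  by_contra hcon
  rw [not_le] at hcon
  obtain ⟨c, hc1, hc2⟩ := EReal.lt_iff_exists_real_btwn.1 hcon
  obtain ⟨c', hc1', hc2'⟩ := EReal.lt_iff_exists_real_btwn.1 hc2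
  have hcc : c < c' := by exact_mod_cast hc1'
  obtain ⟨M, hM⟩ := hHbdd
  let A : Set (Y → ℝ) := convexHull ℝ (Set.range fun x : X => H x)
  have hAconv : Convex ℝ A := convex_convexHull ℝ _
  have hAH : ∀ x, H x ∈ A := fun x => subset_convexHull ℝ _ ⟨x, rfl⟩
  refine core_lemma hY A hAconv hcpt hcl_cont M ?_ c (c' - c) (by linarith) ?_ ?_
  · intro f hf y
    have hconv : Convex ℝ {f : Y → ℝ | ∀ y, |f y| ≤ M} := by
      intro a ha b hb s t hs ht hst y
      have h1 := abs_le.1 (ha y)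
      have h2 := abs_le.1 (hb y)
      simp only [Pi.add_apply, Pi.smul_apply, smul_eq_mul]
      have : M = s * M + t * M := by rw [← add_mul, hst, one_mul]
      rw [abs_le]
      constructor <;> nlinarith
    refine convexHull_min ?_ hconv hf y
    rintro _ ⟨x, rfl⟩
    exact hM x
  · intro D
    by_contra hno
    push Not at hno
    let e := D.equivFin
    let ys : Fin D.card → Y := fun i => (e.symm i : Y)
    let ρ : (Y → ℝ) →ₗ[ℝ] (Fin D.card → ℝ) := LinearMap.funLeft ℝ ℝ ys
    obtain ⟨hn, lam, hlam, hl⟩ := finite_minimax (ρ '' A) (hAconv.linear_image ρ)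
      ⟨_, H (Classical.arbitrary X), hAH _, rfl⟩ c (by
        rintro _ ⟨f, hf, rfl⟩
        obtain ⟨d, hd, h⟩ := hno f hf
        refine ⟨e ⟨d, hd⟩, ?_⟩
        simp only [ρ, LinearMap.funLeft_apply, ys, Equiv.symm_apply_apply]
        exact h.le)
    have h1 : (c : EReal) ≤ ⨅ x : X, ((∑ i, lam i * L x (ys i) : ℝ) : EReal) := by
      refine le_iInf (fun x => ?_)
      rw [EReal.coe_le_coe_iff]
      refine (hl _ ⟨H x, hAH x, rfl⟩).trans ?_
      refine Finset.sum_le_sum (fun i _ => ?_)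
      exact mul_le_mul_of_nonneg_left (hHL x (ys i)) (hlam.1 i)
    have h2 : (c : EReal) ≤ ⨆ y : Y, ⨅ x : X, (L x y : EReal) := by
      rw [hconc]
      exact h1.trans (le_iSup_of_le D.card (le_iSup_of_le hn (le_iSup_of_le ys
        (le_iSup_of_le lam (le_iSup_of_le hlam le_rfl)))))
    exact absurd hc1 (not_lt.2 h2)
  · intro f hf
    obtain ⟨ι, _, wt, z, hw0, hw1, hz, hf'⟩ := mem_convexHull_iff_exists_fintype.1 hf
    choose xs hxs using hz
    let e := Fintype.equivFin ι
    have hn : 0 < Fintype.card ι := by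
      rw [Fintype.card_pos_iff]
      by_contra hemp
      rw [not_nonempty_iff] at hemp
      simp at hw1
    have hlam : (fun i => wt (e.symm i)) ∈ stdSimplex ℝ (Fin (Fintype.card ι)) := by
      refine ⟨fun i => hw0 _, ?_⟩
      rw [← hw1]
      exact Equiv.sum_comp e.symm wt
    have hfy : ∀ y, ∑ i, wt (e.symm i) * H (xs (e.symm i)) y = f y := by
      intro y
      rw [← hf', Equiv.sum_comp e.symm (fun i => wt i * H (xs i) y), Finset.sum_apply]
      refine Finset.sum_congr rfl (fun i _ => ?_)
      rw [← hxs i]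
      rfl
    rw [hHinfsup] at hc2'
    have h1 := hc2'.trans_le (iInf_le_of_le (Fintype.card ι) (iInf_le_of_le hn
      (iInf_le_of_le (fun i => xs (e.symm i)) (iInf_le_of_le (fun i => wt (e.symm i))
        (iInf_le_of_le hlam le_rfl)))))
    obtain ⟨y, hy⟩ := lt_iSup_iff.1 h1
    rw [EReal.coe_lt_coe_iff, hfy] at hy
    exact ⟨y, by linarith⟩
end

section
/- Let Z be a completely regular Hausdorff pseudocompact topological space and (f_n)_{n∈ℕ} a uniformly bounded sequence of continuous real-valued functions on Z. Suppose that (i) the sequence (f_n) converges pointwise to 0 on Z, and (ii) the convex hull conv{f_n : n ∈ ℕ} is relatively compact in C(Z) for the topology of pointwise convergence on Z. Then there exists a sequence (g_k) of convex combinations of the functions (f_n) (i.e. g_k ∈ conv{f_n : n ∈ ℕ} for every k) such that ‖g_k‖_∞ → 0, i.e. (g_k) converges uniformly to 0 on Z. -/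
open Filter Set

/-- One-sided Mazur-type lemma on a compact Hausdorff space. -/
lemma exists_convex_lt_of_compact {X : Type*} [TopologicalSpace X] [CompactSpace X] [T2Space X]
    (F : ℕ → C(X, ℝ)) (C : ℝ) (hC : ∀ n x, |F n x| ≤ C)
    (hF : ∀ x, Tendsto (fun n => F n x) atTop (nhds 0)) (ε : ℝ) (hε : 0 < ε) :
    ∃ g ∈ convexHull ℝ (Set.range F), ∀ x, g x < ε := by
  by_contra hcon
  push Not at hcon
  let B : Set C(X, ℝ) := {h | ∀ x, h x < ε}
  have hBo : IsOpen B := by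
    have := ContinuousMap.isOpen_setOfPred_mapsTo (X := X) (Y := ℝ) isCompact_univ
      (isOpen_Iio (a := ε))
    convert this using 1
    ext h
    simp [B, Set.MapsTo]
  have hBc : Convex ℝ B := by
    intro a ha b hb s t hs ht hst x
    have h1 := ha x
    have h2 := hb x
    have : s * a x + t * b x < ε := by
      have := convex_Iio ε (show a x ∈ Set.Iio ε from h1) (show b x ∈ Set.Iio ε from h2) hs ht hst
      simpa using this
    simpa using this
  obtain ⟨φ, u, hφB, hφA⟩ := geometric_hahn_banach_open hBc hBo (convex_convexHull ℝ (Set.range F))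
    (by
      rw [Set.disjoint_left]
      intro h hB hA
      obtain ⟨x, hx⟩ := hcon h hA
      exact absurd (hB x) (not_lt.2 hx))
  have hu : 0 < u := by simpa using hφB 0 (fun x => by simpa using hε)
  have hpos : ∀ h : C(X, ℝ), 0 ≤ h → 0 ≤ φ h := by
    intro h hh
    by_contra hneg
    push Not at hneg
    have := hφB ((u / φ h) • h) (fun x => by
      have h1 : u / φ h ≤ 0 := (div_neg_of_pos_of_neg hu hneg).le
      have h2 : 0 ≤ h x := hh x
      have : (u / φ h) * h x ≤ 0 := mul_nonpos_of_nonpos_of_nonneg h1 h2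
      simpa using this.trans_lt hε)
    rw [map_smul, smul_eq_mul, div_mul_cancel₀ _ hneg.ne] at this
    exact lt_irrefl _ this
  let Λ₀ : CompactlySupportedContinuousMap X ℝ →ₗ[ℝ] ℝ :=
    { toFun := fun h => φ (h : C(X, ℝ))
      map_add' := fun a b => by
        rw [← map_add]; rfl
      map_smul' := fun a b => by
        rw [RingHom.id_apply, ← map_smul]; rfl }
  let Λ : CompactlySupportedContinuousMap X ℝ →ₚ[ℝ] ℝ :=
    PositiveLinearMap.mk₀ Λ₀ (fun h hh => hpos _ hh)
  letI : MeasurableSpace X := borel X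
  haveI : BorelSpace X := ⟨rfl⟩
  let μ := RealRMK.rieszMeasure Λ
  have hint : ∀ n, ∫ x, F n x ∂μ = φ (F n) := fun n =>
    RealRMK.integral_rieszMeasure Λ (CompactlySupportedContinuousMap.continuousMapEquiv (F n))
  haveI : MeasureTheory.IsFiniteMeasure μ := inferInstance
  have hlim : Tendsto (fun n => ∫ x, F n x ∂μ) atTop (nhds (∫ _, (0 : ℝ) ∂μ)) := by
    refine MeasureTheory.tendsto_integral_of_dominated_convergence (fun _ => C) ?_ ?_ ?_ ?_
    · exact fun n => (F n).continuous.aestronglyMeasurable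
    · exact MeasureTheory.integrable_const C
    · exact fun n => Eventually.of_forall fun x => hC n x
    · exact Eventually.of_forall fun x => hF x
  simp only [hint, MeasureTheory.integral_zero] at hlim
  have := ge_of_tendsto' hlim (fun n => hφA _ (subset_convexHull ℝ _ ⟨n, rfl⟩))
  linarith

/-- A bounded continuous image of a pseudocompact space in `ℕ → ℝ` is compact. -/
lemma isCompact_range_of_pseudocompact {Z : Type*} [TopologicalSpace Z] (hZ : Pseudocompact Z)
    (F : Z → ℕ → ℝ) (hF : Continuous F) (C : ℝ) (hC : ∀ z n, |F z n| ≤ C) :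
    IsCompact (Set.range F) := by
  have hbox : IsCompact (Set.pi Set.univ (fun _ : ℕ => Set.Icc (-C) C)) :=
    isCompact_univ_pi fun _ => isCompact_Icc
  refine hbox.of_isClosed_subset ?_ ?_
  · letI := TopologicalSpace.metrizableSpaceMetric (ℕ → ℝ)
    refine isClosed_of_closure_subset fun p hp => ?_
    by_contra hpn
    have hd : ∀ z, 0 < dist (F z) p := fun z =>
      dist_pos.2 fun h => hpn ⟨z, h⟩
    obtain ⟨M, hM⟩ := hZ ⟨fun z => (dist (F z) p)⁻¹,
      (hF.dist continuous_const).inv₀ fun z => (hd z).ne'⟩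
    have hM1 : 0 < |M| + 1 := by positivity
    obtain ⟨_, ⟨z, rfl⟩, hz⟩ := Metric.mem_closure_iff.1 hp (|M| + 1)⁻¹ (by positivity)
    rw [dist_comm] at hz
    have h1 := (lt_inv_comm₀ (hd z) hM1).1 hz
    have h2 : (dist (F z) p)⁻¹ ≤ M := (le_abs_self _).trans (hM z)
    have := le_abs_self M
    linarith
  · rintro _ ⟨z, rfl⟩ n _
    exact abs_le.1 (hC z n)

/-- **Proposition.** Let `Z` be a completely regular Hausdorff pseudocompact
space and `(f_n)` a uniformly bounded sequence of continuous real functions on `Z` which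
converges pointwise to `0`, with `conv {f_n}` relatively compact in `C(Z)` for the pointwise
topology.  Then some sequence of convex combinations of the `f_n` converges uniformly to
`0` on `Z`. -/
theorem convex_combinations_uniform_pseudocompact {Z : Type*} [TopologicalSpace Z]
    [CompletelyRegularSpace Z] [T2Space Z] (hZ : Pseudocompact Z)
    (f : ℕ → C(Z, ℝ))
    (hub : ∃ C : ℝ, ∀ (n : ℕ) (z : Z), |f n z| ≤ C)
    (hptwise : ∀ z : Z, Tendsto (fun n => f n z) atTop (nhds 0))
    (hcpt : IsCompact
      (closure (convexHull ℝ (Set.range fun n : ℕ => (f n : Z → ℝ))) : Set (Z → ℝ)))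
    (hcl_cont : ∀ g ∈ (closure (convexHull ℝ (Set.range fun n : ℕ => (f n : Z → ℝ)))
        : Set (Z → ℝ)), Continuous g) :
    ∃ g : ℕ → Z → ℝ,
      (∀ k : ℕ, g k ∈ convexHull ℝ (Set.range fun n : ℕ => (f n : Z → ℝ))) ∧
      TendstoUniformly g 0 atTop := by
  obtain ⟨C, hC⟩ := hub
  let F : Z → ℕ → ℝ := fun z n => f n z
  have hFc : Continuous F := continuous_pi fun n => (f n).continuous
  have hK := isCompact_range_of_pseudocompact hZ F hFc C (fun z n => hC n z)
  haveI : CompactSpace (Set.range F) := isCompact_iff_compactSpace.1 hK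
  let s : Bool → ℝ := fun b => if b then 1 else -1
  have hs : Continuous s := continuous_of_discreteTopology
  let G : ℕ → C(Set.range F × Bool, ℝ) := fun n =>
    ⟨fun x => s x.2 * (x.1 : ℕ → ℝ) n, (hs.comp continuous_snd).mul
      ((continuous_apply n).comp (continuous_subtype_val.comp continuous_fst))⟩
  have key : ∀ ε : ℝ, 0 < ε → ∃ g ∈ convexHull ℝ (Set.range fun n : ℕ => (f n : Z → ℝ)),
      ∀ z, |g z| < ε := by
    intro ε hε
    obtain ⟨h, hh, hlt⟩ := exists_convex_lt_of_compact G C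
      (by
        rintro n ⟨⟨_, z, rfl⟩, b⟩
        cases b <;> simpa [G, s, F] using hC n z)
      (by
        rintro ⟨⟨_, z, rfl⟩, b⟩
        simpa [G, F] using (hptwise z).const_mul (s b)) ε hε
    let L : C(Set.range F × Bool, ℝ) →ₗ[ℝ] (Z → ℝ) :=
      { toFun := fun h z => h (⟨F z, z, rfl⟩, true)
        map_add' := fun _ _ => rfl
        map_smul' := fun _ _ => rfl }
    have hL : L h ∈ convexHull ℝ (Set.range fun n : ℕ => (f n : Z → ℝ)) := by
      have h1 : L h ∈ L '' convexHull ℝ (Set.range G) := ⟨h, hh, rfl⟩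
      rw [LinearMap.image_convexHull, ← Set.range_comp] at h1
      convert h1 using 3
      ext n z
      simp [L, G, s, F]
    have hsym : ∀ k, h (k, false) = - h (k, true) := by
      have hsub : convexHull ℝ (Set.range G) ⊆
          {h : C(Set.range F × Bool, ℝ) | ∀ k, h (k, false) = - h (k, true)} := by
        refine convexHull_min ?_ ?_
        · rintro _ ⟨n, rfl⟩ k
          simp [G, s]
        · intro a ha b hb p q _ _ _ k
          have h1 := ha k
          have h2 := hb k
          simp only [ContinuousMap.add_apply, ContinuousMap.smul_apply, h1, h2, smul_eq_mul]
          ring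
      exact hsub hh
    refine ⟨L h, hL, fun z => abs_lt.2 ⟨?_, hlt (⟨F z, z, rfl⟩, true)⟩⟩
    have h1 := hlt (⟨F z, z, rfl⟩, false)
    rw [hsym] at h1
    change -ε < h (⟨F z, z, rfl⟩, true)
    linarith
  choose g hg hgl using fun k : ℕ => key (1 / ((k : ℝ) + 1)) (by positivity)
  refine ⟨g, hg, ?_⟩
  rw [Metric.tendstoUniformly_iff]
  intro ε hε
  have := (tendsto_one_div_add_atTop_nhds_zero_nat (𝕜 := ℝ)).eventually (gt_mem_nhds hε)
  filter_upwards [this] with k hk z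
  simpa using (hgl k z).trans hk
end

section
/- Let Z be a countably compact topological space and Φ a nonempty subset of C(Z) that is uniformly bounded and relatively compact in C(Z) for the topology τ_p of pointwise convergence. Then the τ_p-closed convex hull of Φ (taken in ℝ^Z) is contained in C(Z) and is compact in C(Z) for the topology τ_p. -/
open Filter Set

/-- A topological space is countably compact if every countable open cover has a finite
subcover. -/
def CountablyCompact (Z : Type*) [TopologicalSpace Z] : Prop :=
  ∀ U : ℕ → Set Z, (∀ n, IsOpen (U n)) → (⋃ n, U n) = Set.univ →
    ∃ t : Finset ℕ, (⋃ n ∈ t, U n) = Set.univ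

section Helpers

open Topology MeasureTheory

/-- Countably compact spaces: sequences cluster. -/
lemma CountablyCompact.exists_cluster {Z : Type*} [TopologicalSpace Z]
    (hZ : CountablyCompact Z) (u : ℕ → Z) : ∃ w, MapClusterPt w atTop u := by
  have h : IsCountablyCompact (univ : Set Z) := by
    rw [isCountablyCompact_iff_countable_open_cover]
    intro U hU hc
    obtain ⟨t, ht⟩ := hZ U hU (univ_subset_iff.1 hc)
    exact ⟨t, ht.symm.subset⟩
  obtain ⟨w, -, hw⟩ := isCountablyCompact_iff_seq_clusterPt.1 h u (by simp)
  exact ⟨w, hw⟩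

/-- A cluster point of a convergent sequence is its limit. -/
lemma cluster_eq_lim {u : ℕ → ℝ} {a b : ℝ} (h : MapClusterPt a atTop u)
    (hb : Tendsto u atTop (𝓝 b)) : a = b := by
  have h1 : ClusterPt a (𝓝 b) := h.clusterPt.mono hb
  exact eq_of_nhds_neBot h1

/-- Whitley-type construction. -/
lemma exists_good_seq {Z X : Type*} [TopologicalSpace Z] [TopologicalSpace X] [CompactSpace X]
    (hZ : CountablyCompact Z) (e : X → Z → ℝ) (he1 : ∀ x, Continuous (e x))
    (he2 : ∀ z, Continuous fun x => e x z) (A : Set Z) (z0 : Z) (hA : z0 ∈ closure A) :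
    ∃ z : ℕ → Z, (∀ n, z n ∈ A) ∧ ∀ x, Tendsto (fun n => e x (z n)) atTop (𝓝 (e x z0)) := by
  classical
  have step : ∀ (n : ℕ) (s : Finset Z × Finset X × Z), ∃ s' : Finset Z × Finset X × Z,
      s'.2.2 ∈ A ∧ (∀ x ∈ s.2.1, |e x s'.2.2 - e x z0| < 1 / ((n : ℝ) + 1)) ∧
      s.1 ⊆ s'.1 ∧ s'.2.2 ∈ s'.1 ∧ z0 ∈ s'.1 ∧ s.2.1 ⊆ s'.2.1 ∧
      ∀ x, ∃ y ∈ s'.2.1, ∀ z ∈ s'.1, |e y z - e x z| < 1 / ((n : ℝ) + 1) := by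
    rintro n ⟨S, F, z'⟩
    have hpos : (0 : ℝ) < 1 / ((n : ℝ) + 1) := by positivity
    have hU : IsOpen (⋂ x ∈ F, {z | |e x z - e x z0| < 1 / ((n : ℝ) + 1)}) :=
      isOpen_biInter_finset fun x _ =>
        isOpen_lt (((he1 x).sub continuous_const).abs) continuous_const
    obtain ⟨z, hzU, hzA⟩ := mem_closure_iff.1 hA _ hU (by simp; intros; positivity)
    let S' := insert z0 (insert z S)
    obtain ⟨G, -, hG⟩ := (isCompact_univ (X := X)).elim_nhds_subcover
      (fun y => ⋂ z ∈ S', {x | |e y z - e x z| < 1 / ((n : ℝ) + 1)})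
      (fun y _ => by
        apply IsOpen.mem_nhds
        · exact isOpen_biInter_finset fun z _ =>
            isOpen_lt ((continuous_const.sub (he2 z)).abs) continuous_const
        · simp only [mem_iInter, mem_setOf_eq, sub_self, abs_zero]
          intros; exact hpos)
    refine ⟨(S', F ∪ G, z), hzA, ?_, ?_, ?_, ?_, Finset.subset_union_left, ?_⟩
    · intro x hx
      simp only [mem_iInter, mem_setOf_eq] at hzU
      exact hzU x hx
    · intro a ha; simp [S']; tauto
    · simp [S']
    · simp [S']
    · intro x
      have := hG (mem_univ x)
      simp only [mem_iUnion, mem_iInter, mem_setOf_eq] at this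
      obtain ⟨y, hy, h⟩ := this
      exact ⟨y, Finset.mem_union_right _ hy, h⟩
  choose nx h1 h2 h3 h4 h5 h6 h7 using step
  let st : ℕ → Finset Z × Finset X × Z := fun n =>
    Nat.rec (∅, ∅, z0) (fun k s => nx k s) n
  have hst : ∀ n, st (n + 1) = nx n (st n) := fun n => rfl
  have mS : Monotone fun n => (st n).1 := monotone_nat_of_le_succ fun n => by
    rw [hst]; exact h3 n (st n)
  have mF : Monotone fun n => (st n).2.1 := monotone_nat_of_le_succ fun n => by
    rw [hst]; exact h6 n (st n)
  let z : ℕ → Z := fun n => (st (n + 1)).2.2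
  have lim0 : Tendsto (fun n : ℕ => 1 / ((n : ℝ) + 1)) atTop (𝓝 0) :=
    tendsto_one_div_add_atTop_nhds_zero_nat
  have conv : ∀ (v : ℕ → ℝ) (a : ℝ), (∀ᶠ n in atTop, |v n - a| < 1 / ((n : ℝ) + 1)) →
      Tendsto v atTop (𝓝 a) := by
    intro v a h
    rw [tendsto_iff_dist_tendsto_zero]
    refine squeeze_zero' (Eventually.of_forall fun n => dist_nonneg) ?_ lim0
    filter_upwards [h] with n hn
    rw [Real.dist_eq]; exact hn.le
  -- every cluster point is indistinguishable from z0
  have key : ∀ w, MapClusterPt w atTop z → ∀ x, e x w = e x z0 := by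
    intro w hw x
    have hD : ∀ m, ∀ y ∈ (st m).2.1, e y w = e y z0 := by
      intro m y hy
      refine cluster_eq_lim (hw.tendsto_comp ((he1 y).tendsto w)) (conv _ _ ?_)
      filter_upwards [eventually_ge_atTop m] with n hn
      exact h2 n (st n) y (mF hn hy)
    choose y hy hyx using fun n => h7 n (st n) x
    obtain ⟨x', hx'⟩ := exists_clusterPt_of_compactSpace (map y atTop)
    have hx' : MapClusterPt x' atTop y := hx'
    have hS : ∀ m, ∀ a ∈ (st m).1, e x' a = e x a := by
      intro m a ha
      refine cluster_eq_lim (hx'.tendsto_comp ((he2 a).tendsto x')) (conv _ _ ?_)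
      filter_upwards [eventually_ge_atTop m] with n hn
      exact hyx n a (mS (hn.trans n.le_succ) ha)
    have e1 : e x' w - e x w = 0 := by
      refine cluster_eq_lim
        (hw.tendsto_comp (((he1 x').sub (he1 x)).tendsto w)) ?_
      refine tendsto_const_nhds.congr fun n => ?_
      have := hS (n + 1) (z n) (h4 n (st n))
      simp [this]
    have e2 : e x' w - e x' z0 = 0 := by
      refine cluster_eq_lim
        (hx'.tendsto_comp (((he2 w).sub (he2 z0)).tendsto x')) ?_
      refine tendsto_const_nhds.congr fun n => ?_
      have := hD (n + 1) (y n) (hy n)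
      simp [this]
    have e3 := hS 1 z0 (h5 0 (st 0))
    linarith
  refine ⟨z, fun n => h1 n (st n), fun x => ?_⟩
  by_contra hcon
  rw [Metric.tendsto_atTop] at hcon
  push Not at hcon
  obtain ⟨δ, hδ, hf⟩ := hcon
  obtain ⟨φ, hφ, hφ'⟩ := extraction_of_frequently_atTop
    (frequently_atTop.2 hf : ∃ᶠ n in atTop, δ ≤ dist (e x (z n)) (e x z0))
  obtain ⟨w, hw⟩ := hZ.exists_cluster (z ∘ φ)
  have hwz := key w (hw.of_comp hφ.tendsto_atTop) x
  have hcl : IsClosed {a | δ ≤ dist (e x a) (e x z0)} :=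
    isClosed_le continuous_const ((he1 x).dist continuous_const)
  have : w ∈ {a | δ ≤ dist (e x a) (e x z0)} := by
    refine isClosed_iff_clusterPt.1 hcl w (hw.clusterPt.mono ?_)
    rw [le_principal_iff]
    exact Eventually.of_forall (f := atTop) hφ'
  simp only [mem_setOf_eq, hwz, dist_self] at this
  linarith

/-- Normalized positive linear functionals on `C(X)`. -/
def states (X : Type*) [TopologicalSpace X] : Set (C(X, ℝ) → ℝ) :=
  {L | (∀ f g, L (f + g) = L f + L g) ∧ (∀ (c : ℝ) f, L (c • f) = c * L f) ∧
    (∀ f, 0 ≤ f → 0 ≤ L f) ∧ L 1 = 1}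

lemma states_le {X : Type*} [TopologicalSpace X] [CompactSpace X]
    {L : C(X, ℝ) → ℝ} (hL : L ∈ states X) (f : C(X, ℝ)) : L f ≤ ‖f‖ := by
  obtain ⟨ha, hs, hp, h1⟩ := hL
  have h := hp (‖f‖ • 1 + (-1 : ℝ) • f) (fun x => by
    have := (le_abs_self _).trans (f.norm_coe_le_norm x)
    simpa using this)
  rw [ha, hs, hs, h1] at h
  linarith

lemma isCompact_states (X : Type*) [TopologicalSpace X] [CompactSpace X] :
    IsCompact (states X) := by
  refine IsCompact.of_isClosed_subset
    (isCompact_univ_pi fun f : C(X, ℝ) => isCompact_Icc (a := -‖f‖) (b := ‖f‖)) ?_ ?_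
  · have : states X = (⋂ (f) (g), {L | L (f + g) = L f + L g}) ∩
        ((⋂ (c : ℝ) (f), {L | L (c • f) = c * L f}) ∩
        ((⋂ (f) (_ : 0 ≤ f), {L | 0 ≤ L f}) ∩ {L | L 1 = 1})) := by
      ext L; simp [states]
    rw [this]
    refine IsClosed.inter ?_ (IsClosed.inter ?_ (IsClosed.inter ?_ ?_))
    · exact isClosed_iInter fun f => isClosed_iInter fun g =>
        isClosed_eq (by fun_prop) (by fun_prop)
    · exact isClosed_iInter fun f => isClosed_iInter fun g =>
        isClosed_eq (by fun_prop) (by fun_prop)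
    · exact isClosed_iInter fun f => isClosed_iInter fun g =>
        isClosed_le (by fun_prop) (by fun_prop)
    · exact isClosed_eq (by fun_prop) (by fun_prop)
  · intro L hL f _
    refine ⟨?_, states_le hL f⟩
    have h := states_le hL ((-1 : ℝ) • f)
    rw [hL.2.1] at h
    simp at h
    linarith

lemma convex_states (X : Type*) [TopologicalSpace X] : Convex ℝ (states X) := by
  rintro L ⟨a1, a2, a3, a4⟩ M ⟨b1, b2, b3, b4⟩ s t hs ht hst
  refine ⟨fun f g => ?_, fun c f => ?_, fun f hf => ?_, ?_⟩
  · simp [a1, b1]; ring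
  · simp [a2, b2]; ring
  · have := a3 f hf
    have := b3 f hf
    simp; positivity
  · simp [a4, b4, hst]

/-- Bounded pointwise convergence theorem for positive functionals. -/
lemma states_dct {X : Type*} [TopologicalSpace X] [CompactSpace X] [T2Space X]
    {L : C(X, ℝ) → ℝ} (hL : L ∈ states X) (f : ℕ → C(X, ℝ)) (g : C(X, ℝ)) (C : ℝ)
    (hb : ∀ n x, |f n x| ≤ C) (h : ∀ x, Tendsto (fun n => f n x) atTop (𝓝 (g x))) :
    Tendsto (fun n => L (f n)) atTop (𝓝 (L g)) := by
  letI : MeasurableSpace X := borel X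
  haveI : BorelSpace X := ⟨rfl⟩
  obtain ⟨ha, hs, hp, h1⟩ := hL
  let Λ₀ : CompactlySupportedContinuousMap X ℝ →ₗ[ℝ] ℝ :=
    { toFun := fun k => L k.toContinuousMap
      map_add' := fun a b => ha a.toContinuousMap b.toContinuousMap
      map_smul' := fun c b => hs c b.toContinuousMap }
  let Λ := PositiveLinearMap.mk₀ Λ₀ (fun k hk => hp _ hk)
  have hint : ∀ k : C(X, ℝ), ∫ x, k x ∂(RealRMK.rieszMeasure Λ) = L k := fun k =>
    RealRMK.integral_rieszMeasure Λ (CompactlySupportedContinuousMap.continuousMapEquiv k)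
  simp_rw [← hint]
  refine tendsto_integral_of_dominated_convergence (fun _ => C) ?_ ?_ ?_ ?_
  · intro n; exact (f n).continuous.aestronglyMeasurable
  · exact integrable_const C
  · intro n; exact Eventually.of_forall fun x => hb n x
  · exact Eventually.of_forall h

end Helpers

/-- **Lemma.** Let `Z` be countably compact and `Φ ⊆ C(Z)` nonempty,
uniformly bounded and relatively compact in `C(Z)` for the pointwise topology.  Then the
pointwise-closed convex hull of `Φ` (taken in `ℝ^Z`) consists of continuous functions and is
compact for the pointwise topology. -/
theorem closed_convex_hull_compact {Z : Type*} [TopologicalSpace Z]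
    (hZ : CountablyCompact Z)
    (Φ : Set C(Z, ℝ)) (hΦne : Φ.Nonempty)
    (hub : ∃ C : ℝ, ∀ φ ∈ Φ, ∀ z : Z, |φ z| ≤ C)
    (hcpt : IsCompact (closure ((fun φ : C(Z, ℝ) => (φ : Z → ℝ)) '' Φ) : Set (Z → ℝ)))
    (hcl_cont : ∀ g ∈ (closure ((fun φ : C(Z, ℝ) => (φ : Z → ℝ)) '' Φ) : Set (Z → ℝ)),
      Continuous g) :
    (∀ g ∈ (closure (convexHull ℝ ((fun φ : C(Z, ℝ) => (φ : Z → ℝ)) '' Φ)) : Set (Z → ℝ)),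
        Continuous g) ∧
      IsCompact
        (closure (convexHull ℝ ((fun φ : C(Z, ℝ) => (φ : Z → ℝ)) '' Φ)) : Set (Z → ℝ)) := by
  classical
  set K : Set (Z → ℝ) := closure ((fun φ : C(Z, ℝ) => (φ : Z → ℝ)) '' Φ) with hK
  haveI : CompactSpace K := isCompact_iff_compactSpace.1 hcpt
  let ev : Z → C(K, ℝ) := fun z => ⟨fun f => f.1 z, (continuous_apply z).comp continuous_subtype_val⟩
  let T : (C(K, ℝ) → ℝ) → (Z → ℝ) := fun L z => L (ev z)
  have hT : Continuous T := by fun_prop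
  have hTc : IsCompact (T '' states K) := (isCompact_states K).image hT
  have hconv : Convex ℝ (T '' states K) := by
    rintro _ ⟨L, hL, rfl⟩ _ ⟨M, hM, rfl⟩ s t hs ht hst
    exact ⟨s • L + t • M, convex_states K hL hM hs ht hst, rfl⟩
  have hsub : closure (convexHull ℝ ((fun φ : C(Z, ℝ) => (φ : Z → ℝ)) '' Φ)) ⊆ T '' states K := by
    refine closure_minimal (convexHull_min ?_ hconv) hTc.isClosed
    intro k hk
    refine ⟨fun F => F ⟨k, subset_closure hk⟩, ⟨?_, ?_, ?_, ?_⟩, rfl⟩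
    · intro f g; rfl
    · intro c f; rfl
    · intro f hf; exact hf _
    · rfl
  refine ⟨fun g hg => ?_, hTc.of_isClosed_subset isClosed_closure hsub⟩
  obtain ⟨L, hL, rfl⟩ := hsub hg
  obtain ⟨C, hC⟩ := hub
  have hKC : ∀ k ∈ K, ∀ z, |k z| ≤ C := by
    intro k hk z
    have hcl : IsClosed {k : Z → ℝ | |k z| ≤ C} :=
      isClosed_le (by fun_prop) continuous_const
    refine closure_minimal ?_ hcl hk
    rintro _ ⟨φ, hφ, rfl⟩
    exact hC φ hφ z
  rw [continuous_iff_continuousAt]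
  intro z0
  by_contra hcon
  rw [ContinuousAt, Metric.tendsto_nhds] at hcon
  push Not at hcon
  obtain ⟨ε, hε, hfr⟩ := hcon
  obtain ⟨z, hzA, hz⟩ := exists_good_seq (X := K) hZ (fun k => k.1)
    (fun k => hcl_cont k.1 k.2) (fun z => (continuous_apply z).comp continuous_subtype_val)
    {a | ¬ dist (T L a) (T L z0) < ε} z0 (mem_closure_iff_frequently.2 (by simpa using hfr))
  have hlim : Tendsto (fun n => T L (z n)) atTop (nhds (T L z0)) :=
    states_dct hL (fun n => ev (z n)) (ev z0) C (fun n k => hKC k.1 k.2 (z n)) hz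
  obtain ⟨n, hn⟩ := ((Metric.tendsto_nhds.1 hlim) ε hε).exists
  exact hzA n hn
end

section
/- Let Z be a completely regular Hausdorff countably compact topological space, E a Banach space, and (f_n)_{n∈ℕ} a uniformly bounded sequence of continuous functions from Z into E (i.e. sup_n sup_{z∈Z} ‖f_n(z)‖_E < ∞). Suppose that (f_n) w*-pointwise converges to 0 on Z, meaning that for every continuous linear functional p in the closed unit ball of E* and every z ∈ Z, p(f_n(z)) → 0. Then there exists a sequence (g_k) of convex combinations of the functions (f_n) (i.e. g_k ∈ conv{f_n : n ∈ ℕ} for every k) such that sup_{z∈Z} ‖g_k(z)‖_E → 0, i.e. (g_k) converges uniformly to 0 on Z. -/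
open Filter Set

open MeasureTheory in
open scoped CompactlySupported in
/-- A positive functional on `C(Y)`, `Y` compact Hausdorff, satisfies dominated convergence. -/
theorem tendsto_positive_functional {Y : Type*} [TopologicalSpace Y] [CompactSpace Y] [T2Space Y]
    (φ : C(Y, ℝ) →ₗ[ℝ] ℝ) (hφ : ∀ h : C(Y, ℝ), (∀ y, 0 ≤ h y) → 0 ≤ φ h)
    (F : ℕ → C(Y, ℝ)) (C : ℝ) (hC : ∀ n y, |F n y| ≤ C)
    (hF : ∀ y, Tendsto (fun n => F n y) atTop (nhds 0)) :
    Tendsto (fun n => φ (F n)) atTop (nhds 0) := by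
  letI : MeasurableSpace Y := borel Y
  haveI : BorelSpace Y := ⟨rfl⟩
  let Λ : C_c(Y, ℝ) →ₚ[ℝ] ℝ := PositiveLinearMap.mk₀
    { toFun := fun h => φ h.toContinuousMap
      map_add' := fun a b => φ.map_add a.toContinuousMap b.toContinuousMap
      map_smul' := fun c a => φ.map_smul c a.toContinuousMap }
    (fun h hh => hφ h.toContinuousMap (fun y => hh y))
  have key : ∀ h : C(Y, ℝ), φ h = ∫ y, h y ∂(RealRMK.rieszMeasure Λ) := fun h =>
    (RealRMK.integral_rieszMeasure Λ (CompactlySupportedContinuousMap.continuousMapEquiv h)).symm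
  simp only [key]
  have := tendsto_integral_of_dominated_convergence (μ := RealRMK.rieszMeasure Λ)
    (F := fun n y => F n y) (f := fun _ => 0) (fun _ => C)
    (fun n => (F n).continuous.aestronglyMeasurable_of_compactSpace) (integrable_const C)
    (fun n => Eventually.of_forall fun y => hC n y) (Eventually.of_forall hF)
  simpa using this

theorem continuous_eval_ball {E : Type*} [NormedAddCommGroup E] [NormedSpace ℝ E] :
    Continuous (fun q : E × (WeakDual.toStrongDual ⁻¹' Metric.closedBall (0 : StrongDual ℝ E) 1) =>
      (q.2 : WeakDual ℝ E) q.1) := by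
  refine continuous_prod_of_continuous_lipschitzWith _ 1 ?_ ?_
  · intro a
    exact (WeakDual.eval_continuous a).comp continuous_subtype_val
  · rintro ⟨p, hp⟩
    refine LipschitzWith.of_dist_le_mul fun x y => ?_
    have hp' : ‖WeakDual.toStrongDual p‖ ≤ 1 := by simpa using hp
    have := (WeakDual.toStrongDual p).le_of_opNorm_le hp' (x - y)
    simpa [dist_eq_norm] using this

/-- The key step: some convex combination is uniformly small. -/
theorem exists_small_convex {Z : Type*} [TopologicalSpace Z] (hZ : CountablyCompact Z)
    {E : Type*} [NormedAddCommGroup E] [NormedSpace ℝ E]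
    (f : ℕ → Z → E) (hcont : ∀ n, Continuous (f n))
    (hub : ∃ C : ℝ, ∀ (n : ℕ) (z : Z), ‖f n z‖ ≤ C)
    (hw : ∀ p : E →L[ℝ] ℝ, ‖p‖ ≤ 1 → ∀ z : Z,
      Tendsto (fun n => p (f n z)) atTop (nhds 0)) (ε : ℝ) (hε : 0 < ε) :
    ∃ g ∈ convexHull ℝ (Set.range f), ∀ z, ‖g z‖ ≤ ε := by
  obtain ⟨C, hC⟩ := hub
  let Φ : Z → ℕ → E := fun z n => f n z
  have hΦ : Continuous Φ := continuous_pi hcont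
  have hZc : IsCountablyCompact (univ : Set Z) := by
    rw [isCountablyCompact_iff_countable_open_cover]
    intro U hU hc
    obtain ⟨t, ht⟩ := hZ U hU (univ_subset_iff.1 hc)
    exact ⟨t, ht.ge⟩
  have hL : IsCompact (Set.range Φ) := by
    have := hZc.image hΦ
    rw [image_univ] at this
    exact isCompact_iff_isSeqCompact.2 this.isSeqCompact
  let B : Set (WeakDual ℝ E) := WeakDual.toStrongDual ⁻¹' Metric.closedBall (0 : StrongDual ℝ E) 1
  have hB : IsCompact B := WeakDual.isCompact_closedBall 0 1
  haveI : CompactSpace (Set.range Φ) := isCompact_iff_compactSpace.1 hL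
  haveI : CompactSpace B := isCompact_iff_compactSpace.1 hB
  have hBn : ∀ p : B, ‖WeakDual.toStrongDual (p : WeakDual ℝ E)‖ ≤ 1 := fun p =>
    mem_closedBall_zero_iff.1 p.2
  let F : ℕ → C(Set.range Φ × B, ℝ) := fun n =>
    ⟨fun q => (q.2 : WeakDual ℝ E) ((q.1 : ℕ → E) n),
      continuous_eval_ball.comp (f := fun q : Set.range Φ × B => ((q.1 : ℕ → E) n, q.2))
        (((continuous_apply n).comp (continuous_subtype_val.comp continuous_fst)).prodMk
          continuous_snd)⟩
  have hFC : ∀ n y, |F n y| ≤ C := by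
    rintro n ⟨⟨_, z, rfl⟩, p⟩
    refine ((WeakDual.toStrongDual (p : WeakDual ℝ E)).le_of_opNorm_le (hBn p) (f n z)).trans ?_
    simpa using hC n z
  have hF0 : ∀ y, Tendsto (fun n => F n y) atTop (nhds 0) := by
    rintro ⟨⟨_, z, rfl⟩, p⟩
    exact hw _ (hBn p) z
  let S : Set C(Set.range Φ × B, ℝ) := {h | ∃ g ∈ convexHull ℝ (Set.range f),
    ∀ z (p : B), h (⟨Φ z, z, rfl⟩, p) = (p : WeakDual ℝ E) (g z)}
  let A : Set C(Set.range Φ × B, ℝ) := {h | ∀ y, h y < ε}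
  have hAo : IsOpen A := by
    have := ContinuousMap.isOpen_setOfPred_mapsTo (X := Set.range Φ × B) (Y := ℝ)
      isCompact_univ (isOpen_Iio (a := ε))
    convert this using 1
    ext h
    exact ⟨fun hh y _ => hh y, fun hh y => hh (mem_univ y)⟩
  have hAc : Convex ℝ A := by
    intro a ha b hb s t hs ht hst y
    exact (convex_Iio ε) (ha y) (hb y) hs ht hst
  have hSc : Convex ℝ S := by
    rintro a ⟨g, hg, hga⟩ b ⟨k, hk, hkb⟩ s t hs ht hst
    refine ⟨s • g + t • k, convex_convexHull ℝ _ hg hk hs ht hst, fun z p => ?_⟩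
    simp [hga, hkb]
  by_cases hd : Disjoint A S
  · exfalso
    obtain ⟨φ, u, hA, hS⟩ := geometric_hahn_banach_open hAc hAo hSc hd
    have hu : 0 < u := by
      have := hA 0 (fun y => by simpa using hε)
      simpa using this
    have hpos : ∀ h : C(Set.range Φ × B, ℝ), (∀ y, 0 ≤ h y) → 0 ≤ φ h := by
      intro h hh
      by_contra! hneg
      have := hA ((u / φ h) • h) (fun y => by
        have : u / φ h * h y ≤ 0 :=
          mul_nonpos_of_nonpos_of_nonneg (div_nonpos_of_nonneg_of_nonpos hu.le hneg.le) (hh y)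
        simpa using this.trans_lt hε)
      rw [map_smul, smul_eq_mul, div_mul_cancel₀ _ hneg.ne] at this
      exact lt_irrefl _ this
    have hlim := tendsto_positive_functional (φ : C(Set.range Φ × B, ℝ) →ₗ[ℝ] ℝ) hpos F C hFC hF0
    have : u ≤ 0 := ge_of_tendsto' hlim fun n =>
      hS (F n) ⟨f n, subset_convexHull ℝ _ ⟨n, rfl⟩, fun z p => rfl⟩
    linarith
  · obtain ⟨h, hA, g, hg, hgh⟩ := not_disjoint_iff.1 hd
    refine ⟨g, hg, fun z => ?_⟩
    obtain ⟨p, hp, hpz⟩ := exists_dual_vector'' ℝ (g z)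
    have h1 := hA (⟨Φ z, z, rfl⟩, ⟨StrongDual.toWeakDual p, mem_closedBall_zero_iff.2 hp⟩)
    rw [hgh] at h1
    have h2 : p (g z) < ε := h1
    rw [hpz] at h2
    exact h2.le

/-- **Corollary.** Let `Z` be a completely regular Hausdorff countably
compact space, `E` a Banach space and `(f_n)` a uniformly bounded sequence of continuous
functions `Z → E` which `w*`-pointwise converges to `0` (i.e. `p (f_n z) → 0` for every `p`
in the closed unit ball of `E*` and every `z ∈ Z`).  Then some sequence of convex
combinations of the `f_n` converges uniformly to `0` on `Z`. -/
theorem convex_combinations_uniform_vector_valued {Z : Type*} [TopologicalSpace Z]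
    [CompletelyRegularSpace Z] [T2Space Z] (hZ : CountablyCompact Z)
    {E : Type*} [NormedAddCommGroup E] [NormedSpace ℝ E] [CompleteSpace E]
    (f : ℕ → Z → E) (hcont : ∀ n, Continuous (f n))
    (hub : ∃ C : ℝ, ∀ (n : ℕ) (z : Z), ‖f n z‖ ≤ C)
    (hw : ∀ p : E →L[ℝ] ℝ, ‖p‖ ≤ 1 → ∀ z : Z,
      Tendsto (fun n => p (f n z)) atTop (nhds 0)) :
    ∃ g : ℕ → Z → E,
      (∀ k : ℕ, g k ∈ convexHull ℝ (Set.range f)) ∧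
      TendstoUniformly g 0 atTop := by
  choose g hg hgs using fun k : ℕ =>
    exists_small_convex hZ f hcont hub hw (1 / ((k : ℝ) + 1)) Nat.one_div_pos_of_nat
  refine ⟨g, hg, Metric.tendstoUniformly_iff.2 fun ε hε => ?_⟩
  filter_upwards [(tendsto_one_div_add_atTop_nhds_zero_nat (𝕜 := ℝ)).eventually_lt_const hε]
    with k hk z
  simpa using (hgs k z).trans_lt hk
end
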